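/- There exist universal constants C, c > 0 and, for each (r,p) ∈ [0,1] × [1,∞), a constant c_{r,p} > 0, such that the following is true. Let n ≥ 2, ε ∈ (0,1), and define d' = c_{r,p} times: n·ε² if 0 ≤ r < 1/2 and p < 2−2r; min{n·ε², n·(ln n)^{1−2/p}·ε^{2/p}} if 0 ≤ r < 1/2 and p = 2−2r; min{n·ε², n^{2(1−r)/p}·ε^{2/p}} if 0 ≤ r < 1/2 and p > 2−2r; n·(ln n)^{-1}·ε² if r = 1/2 and p = 1; min{n·(ln n)^{-p}·ε², n^{1/p}·ε^{2/p}} if r = 1/2 and p > 1; min{n^{2(1−r)}·(ln n)^{-(p−1)}·ε², n^{2(1−r)/p}·ε^{2/p}} if 1/2 < r < 1; min{(ln n)³·ε², (ln n)^{1+2/p}·ε^{2/p}} if r = 1. Let G be an n×k random matrix with i.i.d. standard normal entries, where k ≤ d'. Then with probability at least 1 − C·exp(−c·d'), for all x ∈ ℝ^k: (1−ε)·M_{r,p}·|x| ≤ |Gx|_{r,p} ≤ (1+ε)·M_{r,p}·|x|, where M_{r,p} = 𝕄 |Ge₁|_{r,p}. -/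

import Mathlib

open MeasureTheory ProbabilityTheory

/-- `decRe x` is the non-increasing rearrangement of `(|x_1|, …, |x_n|)`
(indexed from `0`, so `decRe x i = x_[i+1]` in the paper's notation). -/
noncomputable def decRe {n : ℕ} (x : Fin n → ℝ) : Fin n → ℝ :=
  fun i => |x (Tuple.sort (fun j => |x j|) i.rev)|

/-- The finite-dimensional Lorentz norm `|x|_{r,p} = (∑_{i=1}^n i^{-r} x_[i]^p)^{1/p}`. -/
noncomputable def lorNorm {n : ℕ} (r p : ℝ) (x : Fin n → ℝ) : ℝ :=
  (∑ i : Fin n, ((i : ℝ) + 1) ^ (-r) * decRe x i ^ p) ^ (1 / p)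

/-- The standard Gaussian measure `N(0, I_n)` on `ℝ^n`. -/
noncomputable def stdGaussian (n : ℕ) : Measure (Fin n → ℝ) :=
  Measure.pi fun _ => gaussianReal 0 1

/-- The law of an `n × k` random matrix with i.i.d. standard normal entries. -/
noncomputable def gaussMatrix (n k : ℕ) : Measure (Fin n → Fin k → ℝ) :=
  Measure.pi fun _ => Measure.pi fun _ => gaussianReal 0 1

/-- `mulVec g x = Gx`, the matrix-vector product. -/
noncomputable def mulVec {n k : ℕ} (g : Fin n → Fin k → ℝ) (x : Fin k → ℝ) : Fin n → ℝ :=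
  fun i => ∑ j : Fin k, g i j * x j

/-- The Euclidean norm on `Fin k → ℝ`. -/
noncomputable def eucNorm {k : ℕ} (x : Fin k → ℝ) : ℝ :=
  Real.sqrt (∑ j : Fin k, x j ^ 2)

/-- `m` is a median of `f` under `μ`. -/
def IsMedian {α : Type*} [MeasurableSpace α] (μ : Measure α) (f : α → ℝ) (m : ℝ) : Prop :=
  (1 : ENNReal) / 2 ≤ μ {x | m ≤ f x} ∧ (1 : ENNReal) / 2 ≤ μ {x | f x ≤ m}

/-- The dimension `d'` of Corollary `Corrasy`, without the coefficient `c_{r,p}`. -/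
noncomputable def dimAsy (n : ℕ) (r p ε : ℝ) : ℝ :=
  if r < 1 / 2 then
    (if p < 2 - 2 * r then (n : ℝ) * ε ^ 2
     else if p = 2 - 2 * r then
       min ((n : ℝ) * ε ^ 2) ((n : ℝ) * Real.log n ^ (1 - 2 / p) * ε ^ (2 / p))
     else
       min ((n : ℝ) * ε ^ 2) ((n : ℝ) ^ (2 * (1 - r) / p) * ε ^ (2 / p)))
  else if r = 1 / 2 then
    (if p = 1 then (n : ℝ) * Real.log n ^ (-(1 : ℝ)) * ε ^ 2
     else
       min ((n : ℝ) * Real.log n ^ (-p) * ε ^ 2) ((n : ℝ) ^ (1 / p) * ε ^ (2 / p)))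
  else if r < 1 then
    min ((n : ℝ) ^ (2 * (1 - r)) * Real.log n ^ (-(p - 1)) * ε ^ 2)
      ((n : ℝ) ^ (2 * (1 - r) / p) * ε ^ (2 / p))
  else
    min (Real.log n ^ (3 : ℝ) * ε ^ 2) (Real.log n ^ (1 + 2 / p) * ε ^ (2 / p))

instance (n : ℕ) : IsProbabilityMeasure (_root_.stdGaussian n) := by
  unfold _root_.stdGaussian; infer_instance

instance (n k : ℕ) : IsProbabilityMeasure (gaussMatrix n k) := by
  unfold gaussMatrix; infer_instance

/-- Two orthonormal linear functionals of a standard Gaussian vector are independent standard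
Gaussians. -/
lemma map_pi_gaussianReal_of_orthonormal {k : ℕ} {u v : EuclideanSpace ℝ (Fin k)}
    (hu : ‖u‖ = 1) (hv : ‖v‖ = 1) (huv : inner ℝ u v = 0) :
    (Measure.pi fun _ : Fin k => gaussianReal 0 1).map
      (fun h => (∑ j, h j * u j, ∑ j, h j * v j)) =
      (gaussianReal 0 1).prod (gaussianReal 0 1) := by
  set P := ProbabilityTheory.stdGaussian (EuclideanSpace ℝ (Fin k)) with hP
  have h1 : (Measure.pi fun _ : Fin k => gaussianReal 0 1).map
      (fun h => (∑ j, h j * u j, ∑ j, h j * v j)) =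
      P.map (fun x => (innerSL ℝ u x, innerSL ℝ v x)) := by
    rw [hP, ← map_pi_eq_stdGaussian, Measure.map_map (by fun_prop) (by fun_prop)]
    congr 1
  have hG : HasGaussianLaw (fun x => (innerSL ℝ u x, innerSL ℝ v x)) P :=
    IsGaussian.hasGaussianLaw_id.map_fun ((innerSL ℝ u).prod (innerSL ℝ v))
  have hcov : cov[fun x => innerSL ℝ u x, fun x => innerSL ℝ v x; P] = 0 := by
    have := covarianceBilin_apply_eq_cov (μ := P) IsGaussian.memLp_two_id u v
    rw [hP, covarianceBilin_stdGaussian] at this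
    simp only [innerSL_apply_apply] at this ⊢
    rw [← this]; exact huv
  have hind := hG.indepFun_of_covariance_eq_zero hcov
  have hlaw : ∀ w : EuclideanSpace ℝ (Fin k), ‖w‖ = 1 →
      P.map (fun x => innerSL ℝ w x) = gaussianReal 0 1 := by
    intro w hw
    have := (IsGaussian.hasGaussianLaw_id (μ := P)).map_fun (innerSL ℝ w)
    have h2 := this.map_eq_gaussianReal
    simp only [id] at h2
    rw [h2, hP, integral_strongDual_stdGaussian, variance_dual_stdGaussian]
    simp [hw]
  rw [h1, hind.map_prod_eq_prod_map_map (by fun_prop) (by fun_prop), hlaw u hu, hlaw v hv]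

lemma measurable_mulVec {n k : ℕ} (x : Fin k → ℝ) :
    Measurable (fun g : Fin n → Fin k → ℝ => mulVec g x) := by
  unfold mulVec; fun_prop

/-- Images of two orthonormal vectors under a Gaussian matrix are independent standard Gaussian
vectors. -/
lemma map_gaussMatrix_of_orthonormal {n k : ℕ} {u v : EuclideanSpace ℝ (Fin k)}
    (hu : ‖u‖ = 1) (hv : ‖v‖ = 1) (huv : inner ℝ u v = 0) :
    (gaussMatrix n k).map (fun g => (mulVec g u.ofLp, mulVec g v.ofLp)) =
      (_root_.stdGaussian n).prod (_root_.stdGaussian n) := by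
  have h1 := (measurePreserving_arrowProdEquivProdArrow ℝ ℝ (Fin n)
    (fun _ => gaussianReal 0 1) (fun _ => gaussianReal 0 1)).map_eq
  have hrow := map_pi_gaussianReal_of_orthonormal hu hv huv
  have h2 : (gaussMatrix n k).map (fun (g : Fin n → Fin k → ℝ) (i : Fin n) =>
      (∑ j, g i j * u j, ∑ j, g i j * v j)) =
      Measure.pi fun _ : Fin n => (gaussianReal 0 1).prod (gaussianReal 0 1) := by
    have : ∀ i : Fin n, SigmaFinite ((Measure.pi fun _ : Fin k => gaussianReal 0 1).map
      (fun h => (∑ j, h j * u j, ∑ j, h j * v j))) := fun _ => by rw [hrow]; infer_instance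
    rw [gaussMatrix, Measure.pi_map_pi
      (f := fun (_ : Fin n) (h : Fin k → ℝ) => (∑ j, h j * u j, ∑ j, h j * v j))
      (fun i => Measurable.aemeasurable (by fun_prop))]
    simp_rw [hrow]
  rw [_root_.stdGaussian, ← h1, ← h2, Measure.map_map (by fun_prop) (by fun_prop)]
  congr 1

/-- The image of a unit vector under a Gaussian matrix is a standard Gaussian vector. -/
lemma map_gaussMatrix_of_unit {n k : ℕ} {u : EuclideanSpace ℝ (Fin k)} (hu : ‖u‖ = 1) :
    (gaussMatrix n k).map (fun g => mulVec g u.ofLp) = _root_.stdGaussian n := by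
  have hlaw : (Measure.pi fun _ : Fin k => gaussianReal 0 1).map
      (fun h => ∑ j, h j * u j) = gaussianReal 0 1 := by
    set P := ProbabilityTheory.stdGaussian (EuclideanSpace ℝ (Fin k)) with hP
    have h1 : (Measure.pi fun _ : Fin k => gaussianReal 0 1).map (fun h => ∑ j, h j * u j) =
        P.map (fun x => innerSL ℝ u x) := by
      rw [hP, ← map_pi_eq_stdGaussian, Measure.map_map (by fun_prop) (by fun_prop)]
      congr 1
    have h2 := ((IsGaussian.hasGaussianLaw_id (μ := P)).map_fun (innerSL ℝ u)).map_eq_gaussianReal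
    simp only [id] at h2
    rw [h1, h2, hP, integral_strongDual_stdGaussian, variance_dual_stdGaussian]
    simp [hu]
  have : ∀ i : Fin n, SigmaFinite ((Measure.pi fun _ : Fin k => gaussianReal 0 1).map
      (fun h => ∑ j, h j * u j)) := fun _ => by rw [hlaw]; infer_instance
  have := Measure.pi_map_pi (μ := fun _ : Fin n => Measure.pi fun _ : Fin k => gaussianReal 0 1)
      (f := fun (_ : Fin n) (h : Fin k → ℝ) => ∑ j, h j * u j)
      (fun i => Measurable.aemeasurable (by fun_prop))
  simp_rw [hlaw] at this
  exact this

open scoped Convolution NNReal in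
/-- Lipschitz functions are uniform limits of smooth functions with the same Lipschitz constant. -/
lemma LipschitzWith.exists_contDiff_approx {E : Type*} [NormedAddCommGroup E] [NormedSpace ℝ E]
    [FiniteDimensional ℝ E] {F : E → ℝ} {L : ℝ≥0} (hF : LipschitzWith L F) {η : ℝ} (hη : 0 < η) :
    ∃ F' : E → ℝ, ContDiff ℝ 1 F' ∧ LipschitzWith L F' ∧ ∀ x, |F' x - F x| ≤ η := by
  borelize E
  obtain ⟨δ, hδ, hFδ⟩ := Metric.uniformContinuous_iff.mp hF.uniformContinuous η hη
  set φ : ContDiffBump (0 : E) := ⟨δ / 2, δ, half_pos hδ, half_lt_self hδ⟩ with hφ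
  have hloc : LocallyIntegrable F (Measure.addHaar : Measure E) := hF.continuous.locallyIntegrable
  set H : E → ℝ := φ.normed Measure.addHaar ⋆[ContinuousLinearMap.lsmul ℝ ℝ, Measure.addHaar] F
    with hH
  have hsm : ContDiff ℝ 1 H :=
    φ.hasCompactSupport_normed.contDiff_convolution_left _ φ.contDiff_normed hloc
  have hex := φ.hasCompactSupport_normed (μ := (Measure.addHaar : Measure E)).convolutionExists_left
    (ContinuousLinearMap.lsmul ℝ ℝ) φ.continuous_normed hloc
  refine ⟨H, hsm, LipschitzWith.of_dist_le_mul fun x y => ?_, fun x => ?_⟩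
  · rw [Real.dist_eq, hH]
    simp only [convolution_def, ContinuousLinearMap.lsmul_apply, smul_eq_mul]
    have hx := hex x
    have hy := hex y
    simp only [ConvolutionExistsAt, ContinuousLinearMap.lsmul_apply, smul_eq_mul] at hx hy
    rw [← integral_sub hx hy]
    calc |∫ t, (φ.normed Measure.addHaar t * F (x - t) - φ.normed Measure.addHaar t * F (y - t))
            ∂Measure.addHaar|
        ≤ ∫ t, φ.normed Measure.addHaar t * (L * dist x y) ∂Measure.addHaar := by
          rw [← Real.norm_eq_abs]
          refine norm_integral_le_of_norm_le (φ.integrable_normed.mul_const _)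
            (Filter.Eventually.of_forall fun t => ?_)
          rw [← mul_sub, norm_mul, Real.norm_of_nonneg (φ.nonneg_normed t)]
          refine mul_le_mul_of_nonneg_left ?_ (φ.nonneg_normed t)
          have := hF.dist_le_mul (x - t) (y - t)
          rwa [Real.dist_eq, dist_sub_right] at this
      _ = L * dist x y := by rw [integral_mul_const, φ.integral_normed, one_mul]
  · have := φ.dist_normed_convolution_le (μ := (Measure.addHaar : Measure E)) (x₀ := x) (ε := η)
      hloc.aestronglyMeasurable (fun y hy => (hFδ hy).le)
    simpa [Real.dist_eq] using this

lemma lintegral_exp_dual_stdGaussian {n : ℕ} (l : StrongDual ℝ (EuclideanSpace ℝ (Fin n))) :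
    ∫⁻ y, ENNReal.ofReal (Real.exp (l (WithLp.toLp 2 y))) ∂(_root_.stdGaussian n) =
      ENNReal.ofReal (Real.exp (‖l‖ ^ 2 / 2)) := by
  set P := ProbabilityTheory.stdGaussian (EuclideanSpace ℝ (Fin n)) with hP
  have h1 : ∫⁻ y, ENNReal.ofReal (Real.exp (l (WithLp.toLp 2 y))) ∂(_root_.stdGaussian n) =
      ∫⁻ x, ENNReal.ofReal (Real.exp (l x)) ∂P := by
    rw [hP, ← map_pi_eq_stdGaussian, lintegral_map (by fun_prop) (by fun_prop)]
    rfl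
  have h2 := ((IsGaussian.hasGaussianLaw_id (μ := P)).map_fun l).map_eq_gaussianReal
  simp only [id] at h2
  rw [hP, integral_strongDual_stdGaussian, variance_dual_stdGaussian, ← hP] at h2
  have h3 : ∫⁻ x, ENNReal.ofReal (Real.exp (l x)) ∂P =
      ∫⁻ t, ENNReal.ofReal (Real.exp t) ∂(gaussianReal 0 (‖l‖ ^ 2).toNNReal) := by
    rw [← h2, lintegral_map (by fun_prop) (by fun_prop)]
  have h_int := integrable_exp_mul_gaussianReal (μ := 0) (v := (‖l‖ ^ 2).toNNReal) 1
  simp only [one_mul] at h_int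
  rw [h1, h3, ← ofReal_integral_eq_lintegral_ofReal h_int
    (Filter.Eventually.of_forall fun t => (Real.exp_pos t).le)]
  have h4 := mgf_gaussianReal (p := gaussianReal 0 (‖l‖ ^ 2).toNNReal) (X := id)
    (μ := 0) (v := (‖l‖ ^ 2).toNNReal) (by simp) 1
  simp only [mgf, id, one_mul] at h4
  rw [h4]
  simp

/-- The image of `x` under the matrix `g`, as a vector of Euclidean space. -/
noncomputable def eucMulVec {n k : ℕ} (g : Fin n → Fin k → ℝ) (x : EuclideanSpace ℝ (Fin k)) :
    EuclideanSpace ℝ (Fin n) := WithLp.toLp 2 (mulVec g x.ofLp)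

lemma eucMulVec_add {n k : ℕ} (g : Fin n → Fin k → ℝ) (x y : EuclideanSpace ℝ (Fin k)) :
    eucMulVec g (x + y) = eucMulVec g x + eucMulVec g y := by
  ext i; simp [eucMulVec, mulVec, mul_add, Finset.sum_add_distrib]

lemma eucMulVec_smul {n k : ℕ} (g : Fin n → Fin k → ℝ) (c : ℝ) (x : EuclideanSpace ℝ (Fin k)) :
    eucMulVec g (c • x) = c • eucMulVec g x := by
  ext i
  simp only [eucMulVec, mulVec, PiLp.smul_apply, smul_eq_mul, Finset.mul_sum]
  exact Finset.sum_congr rfl fun j _ => by ring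

lemma continuous_eucMulVec {n k : ℕ} :
    Continuous fun z : (Fin n → Fin k → ℝ) × EuclideanSpace ℝ (Fin k) => eucMulVec z.1 z.2 := by
  unfold eucMulVec mulVec; fun_prop

/-- Exponential Maurey–Pisier inequality along an arc of angle `α`, for `C¹` functions. -/
lemma lintegral_exp_arc_of_contDiff {n k : ℕ} {u v : EuclideanSpace ℝ (Fin k)}
    (hu : ‖u‖ = 1) (hv : ‖v‖ = 1) (huv : inner ℝ u v = 0)
    {F : EuclideanSpace ℝ (Fin n) → ℝ} {L : NNReal} (hF : ContDiff ℝ 1 F) (hL : LipschitzWith L F)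
    (α s : ℝ) :
    ∫⁻ g, ENNReal.ofReal (Real.exp (s * (F (eucMulVec g (Real.cos α • u + Real.sin α • v)) -
      F (eucMulVec g u)))) ∂(gaussMatrix n k) ≤
      ENNReal.ofReal (Real.exp (s ^ 2 * α ^ 2 * L ^ 2 / 2)) := by
  set a : ℝ → EuclideanSpace ℝ (Fin k) := fun t => Real.cos (α * t) • u + Real.sin (α * t) • v
    with ha
  set b : ℝ → EuclideanSpace ℝ (Fin k) := fun t => -Real.sin (α * t) • u + Real.cos (α * t) • v
    with hb
  have hac : Continuous a := by fun_prop
  have hbc : Continuous b := by fun_prop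
  have hvu : inner ℝ v u = 0 := by rw [real_inner_comm]; exact huv
  have hcs : ∀ t, Real.cos t * Real.cos t + Real.sin t * Real.sin t = 1 := fun t => by
    have := Real.cos_sq_add_sin_sq t; nlinarith
  have hna : ∀ t, ‖a t‖ = 1 := fun t => by
    have h1 : inner ℝ (a t) (a t) = 1 := by
      simp only [ha, inner_add_left, inner_add_right, inner_smul_left, inner_smul_right, huv, hvu,
        real_inner_self_eq_norm_sq, hu, hv]
      simpa using hcs (α * t)
    rw [real_inner_self_eq_norm_sq] at h1
    nlinarith [norm_nonneg (a t)]
  have hnb : ∀ t, ‖b t‖ = 1 := fun t => by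
    have h1 : inner ℝ (b t) (b t) = 1 := by
      simp only [hb, inner_add_left, inner_add_right, inner_smul_left, inner_smul_right, huv, hvu,
        real_inner_self_eq_norm_sq, hu, hv]
      simp
      linarith [hcs (α * t)]
    rw [real_inner_self_eq_norm_sq] at h1
    nlinarith [norm_nonneg (b t)]
  have hab : ∀ t, inner ℝ (a t) (b t) = 0 := fun t => by
    simp only [ha, hb, inner_add_left, inner_add_right, inner_smul_left, inner_smul_right, huv, hvu,
      real_inner_self_eq_norm_sq, hu, hv]
    simp
    ring
  set D : (Fin n → Fin k → ℝ) → ℝ → ℝ := fun g t =>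
    s * (α * fderiv ℝ F (eucMulVec g (a t)) (eucMulVec g (b t))) with hD
  have hF' : Continuous (fderiv ℝ F) := hF.continuous_fderiv (by norm_num)
  have hDc : Continuous (fun z : (Fin n → Fin k → ℝ) × ℝ => D z.1 z.2) := by
    have h1 : Continuous fun z : (Fin n → Fin k → ℝ) × ℝ => eucMulVec z.1 (a z.2) :=
      continuous_eucMulVec.comp (continuous_fst.prodMk (hac.comp continuous_snd))
    have h2 : Continuous fun z : (Fin n → Fin k → ℝ) × ℝ => eucMulVec z.1 (b z.2) :=
      continuous_eucMulVec.comp (continuous_fst.prodMk (hbc.comp continuous_snd))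
    have h3 := (hF'.comp h1).clm_apply h2
    exact continuous_const.mul (continuous_const.mul h3)
  have hDg : ∀ g, Continuous (D g) := fun g => hDc.comp (by fun_prop : Continuous fun t => (g, t))
  set ν : Measure ℝ := volume.restrict (Set.Ioc 0 1) with hν
  have : IsProbabilityMeasure ν := ⟨by simp [hν]⟩
  have hii : ∀ f : ℝ → ℝ, Continuous f → Integrable f ν := fun f hf =>
    (intervalIntegrable_iff_integrableOn_Ioc_of_le zero_le_one).1 (hf.intervalIntegrable 0 1)
  have hftc : ∀ g, s * (F (eucMulVec g (Real.cos α • u + Real.sin α • v)) - F (eucMulVec g u)) =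
      ∫ t, D g t ∂ν := by
    intro g
    have hder : ∀ t ∈ Set.uIcc (0 : ℝ) 1,
        HasDerivAt (fun t => s * F (eucMulVec g (a t))) (D g t) t := by
      intro t _
      have h1 : HasDerivAt (fun t => eucMulVec g (a t)) (α • eucMulVec g (b t)) t := by
        have h2 : (fun t => eucMulVec g (a t)) = fun t => Real.cos (α * t) • eucMulVec g u +
            Real.sin (α * t) • eucMulVec g v := by
          ext t; simp [ha, eucMulVec_add, eucMulVec_smul]
        have h3 : α • eucMulVec g (b t) = (-Real.sin (α * t) * α) • eucMulVec g u +
            (Real.cos (α * t) * α) • eucMulVec g v := by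
          rw [hb]; simp only [eucMulVec_add, eucMulVec_smul]
          module
        rw [h2, h3]
        have hl : HasDerivAt (fun t : ℝ => α * t) α t := by
          simpa using (hasDerivAt_id t).const_mul α
        exact (hl.cos.smul_const _).add (hl.sin.smul_const _)
      have h4 := ((hF.differentiable (by norm_num)) (eucMulVec g (a t))).hasFDerivAt
      have h5 := (h4.comp_hasDerivAt t h1).const_mul s
      simpa [hD] using h5
    have := intervalIntegral.integral_eq_sub_of_hasDerivAt hder ((hDg g).intervalIntegrable 0 1)
    rw [intervalIntegral.integral_of_le zero_le_one] at this
    rw [hν, this]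
    simp [ha, mul_sub]
  have hjen : ∀ g, ENNReal.ofReal (Real.exp (∫ t, D g t ∂ν)) ≤
      ∫⁻ t, ENNReal.ofReal (Real.exp (D g t)) ∂ν := by
    intro g
    have hie : Integrable (fun t => Real.exp (D g t)) ν := hii _ (Real.continuous_exp.comp (hDg g))
    rw [← ofReal_integral_eq_lintegral_ofReal hie
      (Filter.Eventually.of_forall fun t => (Real.exp_pos _).le)]
    exact ENNReal.ofReal_le_ofReal (convexOn_exp.map_integral_le Real.continuous_exp.continuousOn
      isClosed_univ (by simp) (hii _ (hDg g)) hie)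
  have hin : ∀ t, ∫⁻ g, ENNReal.ofReal (Real.exp (D g t)) ∂(gaussMatrix n k) ≤
      ENNReal.ofReal (Real.exp (s ^ 2 * α ^ 2 * L ^ 2 / 2)) := by
    intro t
    have hlaw := map_gaussMatrix_of_orthonormal (n := n) (hna t) (hnb t) (hab t)
    set Ψ : (Fin n → ℝ) × (Fin n → ℝ) → ENNReal := fun z =>
      ENNReal.ofReal (Real.exp (s * (α * fderiv ℝ F (WithLp.toLp 2 z.1) (WithLp.toLp 2 z.2))))
      with hΨ
    have hΨm : Measurable Ψ := by
      refine ENNReal.measurable_ofReal.comp (Continuous.measurable ?_)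
      refine Real.continuous_exp.comp (continuous_const.mul (continuous_const.mul ?_))
      exact (hF'.comp (by fun_prop)).clm_apply (by fun_prop)
    have h1 : ∫⁻ g, ENNReal.ofReal (Real.exp (D g t)) ∂(gaussMatrix n k) =
        ∫⁻ z, Ψ z ∂((_root_.stdGaussian n).prod (_root_.stdGaussian n)) := by
      rw [← hlaw, lintegral_map hΨm ((measurable_mulVec _).prodMk (measurable_mulVec _))]
      rfl
    rw [h1, lintegral_prod _ hΨm.aemeasurable]
    calc ∫⁻ x, ∫⁻ y, Ψ (x, y) ∂(_root_.stdGaussian n) ∂(_root_.stdGaussian n)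
        ≤ ∫⁻ x, ENNReal.ofReal (Real.exp (s ^ 2 * α ^ 2 * L ^ 2 / 2)) ∂(_root_.stdGaussian n) := by
          refine lintegral_mono fun x => ?_
          have h2 := lintegral_exp_dual_stdGaussian ((s * α) • fderiv ℝ F (WithLp.toLp 2 x))
          have h3 : ∀ y, Ψ (x, y) = ENNReal.ofReal (Real.exp
              (((s * α) • fderiv ℝ F (WithLp.toLp 2 x)) (WithLp.toLp 2 y))) := by
            intro y; simp [hΨ, mul_assoc]
          simp_rw [h3]
          rw [h2]
          refine ENNReal.ofReal_le_ofReal (Real.exp_le_exp.2 ?_)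
          have h4 := norm_fderiv_le_of_lipschitz ℝ hL (x₀ := WithLp.toLp 2 x)
          rw [norm_smul, mul_pow, Real.norm_eq_abs, sq_abs, mul_pow]
          have : ‖fderiv ℝ F (WithLp.toLp 2 x)‖ ^ 2 ≤ (L : ℝ) ^ 2 :=
            pow_le_pow_left₀ (norm_nonneg _) h4 2
          have h5 := mul_le_mul_of_nonneg_left this (by positivity : 0 ≤ s ^ 2 * α ^ 2)
          linarith
      _ = _ := by simp
  calc _ = ∫⁻ g, ENNReal.ofReal (Real.exp (∫ t, D g t ∂ν)) ∂(gaussMatrix n k) := by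
        simp_rw [hftc]
    _ ≤ ∫⁻ g, ∫⁻ t, ENNReal.ofReal (Real.exp (D g t)) ∂ν ∂(gaussMatrix n k) :=
        lintegral_mono hjen
    _ = ∫⁻ t, ∫⁻ g, ENNReal.ofReal (Real.exp (D g t)) ∂(gaussMatrix n k) ∂ν := by
        refine lintegral_lintegral_swap (Measurable.aemeasurable ?_)
        exact ENNReal.measurable_ofReal.comp (Real.continuous_exp.comp hDc).measurable
    _ ≤ ∫⁻ t, ENNReal.ofReal (Real.exp (s ^ 2 * α ^ 2 * L ^ 2 / 2)) ∂ν := lintegral_mono hin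
    _ = _ := by simp

/-- Subgaussian tail of the increment of a Lipschitz function along an arc of angle `α`. -/
lemma measure_arc_increment_ge {n k : ℕ} {u v : EuclideanSpace ℝ (Fin k)}
    (hu : ‖u‖ = 1) (hv : ‖v‖ = 1) (huv : inner ℝ u v = 0)
    {F : EuclideanSpace ℝ (Fin n) → ℝ} {L : NNReal} (hL : LipschitzWith L F) (hL0 : 0 < L)
    {α t : ℝ} (hα : 0 < α) (ht : 0 ≤ t) :
    gaussMatrix n k {g | t ≤ F (eucMulVec g (Real.cos α • u + Real.sin α • v)) -
      F (eucMulVec g u)} ≤ ENNReal.ofReal (Real.exp (-(t ^ 2 / (2 * α ^ 2 * L ^ 2)))) := by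
  have hL0' : (0 : ℝ) < L := hL0
  set w := Real.cos α • u + Real.sin α • v
  set s : ℝ := t / (α ^ 2 * L ^ 2) with hs
  have hs0 : 0 ≤ s := by positivity
  have key : ∀ η : ℝ, 0 < η → gaussMatrix n k {g | t ≤ F (eucMulVec g w) - F (eucMulVec g u)} ≤
      ENNReal.ofReal (Real.exp (-(t ^ 2 / (2 * α ^ 2 * L ^ 2)) + s * (2 * η))) := by
    intro η hη
    obtain ⟨F', hF', hL', happ⟩ := hL.exists_contDiff_approx hη
    have hI := lintegral_exp_arc_of_contDiff (n := n) hu hv huv hF' hL' α s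
    set Z : (Fin n → Fin k → ℝ) → ENNReal := fun g =>
      ENNReal.ofReal (Real.exp (s * (F' (eucMulVec g w) - F' (eucMulVec g u)))) with hZ
    have hZm : Measurable Z := by
      refine ENNReal.measurable_ofReal.comp (Continuous.measurable ?_)
      have hc : ∀ x : EuclideanSpace ℝ (Fin k),
          Continuous fun g : Fin n → Fin k → ℝ => F' (eucMulVec g x) := fun x =>
        hL'.continuous.comp (continuous_eucMulVec.comp (by fun_prop :
          Continuous fun g : Fin n → Fin k → ℝ => (g, x)))
      exact Real.continuous_exp.comp (continuous_const.mul ((hc w).sub (hc u)))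
    have hM := mul_meas_ge_le_lintegral (μ := gaussMatrix n k) hZm
      (ENNReal.ofReal (Real.exp (s * (t - 2 * η))))
    have hsub : {g | t ≤ F (eucMulVec g w) - F (eucMulVec g u)} ⊆
        {g | ENNReal.ofReal (Real.exp (s * (t - 2 * η))) ≤ Z g} := by
      intro g hg
      simp only [Set.mem_ofPred_eq, hZ] at hg ⊢
      refine ENNReal.ofReal_le_ofReal (Real.exp_le_exp.2 (mul_le_mul_of_nonneg_left ?_ hs0))
      have h1 := abs_le.1 (happ (eucMulVec g w))
      have h2 := abs_le.1 (happ (eucMulVec g u))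
      linarith [h1.1, h2.2]
    refine (measure_mono hsub).trans ?_
    have hpos : ENNReal.ofReal (Real.exp (s * (t - 2 * η))) ≠ 0 := by
      simp [Real.exp_pos]
    have h3 := (ENNReal.le_div_iff_mul_le (Or.inl hpos) (Or.inl ENNReal.ofReal_ne_top)).2
      ((mul_comm _ _).le.trans (hM.trans hI))
    refine h3.trans ?_
    rw [← ENNReal.ofReal_div_of_pos (Real.exp_pos _), ← Real.exp_sub]
    refine ENNReal.ofReal_le_ofReal (Real.exp_le_exp.2 (le_of_eq ?_))
    rw [hs]
    field_simp
    ring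
  refine ge_of_tendsto (x := nhdsWithin (0 : ℝ) (Set.Ioi 0)) (f := fun η : ℝ =>
    ENNReal.ofReal (Real.exp (-(t ^ 2 / (2 * α ^ 2 * L ^ 2)) + s * (2 * η)))) ?_
    (by filter_upwards [self_mem_nhdsWithin] with η hη using key η hη)
  have hc : Continuous fun η : ℝ =>
      ENNReal.ofReal (Real.exp (-(t ^ 2 / (2 * α ^ 2 * L ^ 2)) + s * (2 * η))) := by
    exact ENNReal.continuous_ofReal.comp (by fun_prop)
  have := (hc.tendsto 0).mono_left (nhdsWithin_le_nhds (s := Set.Ioi 0))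
  simpa using this

/-- Separated subsets of the unit sphere of `ℝ^k` have at most `(1 + 2/η)^k` elements. -/
lemma card_le_of_separated_sphere {k : ℕ} {η : ℝ} (hη : 0 < η)
    (s : Finset (EuclideanSpace ℝ (Fin k))) (hs : ∀ c ∈ s, ‖c‖ = 1)
    (h : ∀ c ∈ s, ∀ d ∈ s, c ≠ d → η ≤ ‖c - d‖) : (s.card : ℝ) ≤ (1 + 2 / η) ^ k := by
  let μ : Measure (EuclideanSpace ℝ (Fin k)) := volume
  have δpos : 0 < η / 2 := by positivity
  have ρpos : 0 < 1 + η / 2 := by positivity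
  set A := ⋃ c ∈ s, Metric.ball c (η / 2) with hA
  have D : Set.Pairwise (s : Set (EuclideanSpace ℝ (Fin k)))
      (Function.onFun Disjoint fun c => Metric.ball c (η / 2)) := by
    rintro c hc d hd hcd
    apply Metric.ball_disjoint_ball
    rw [dist_eq_norm]
    linarith [h c hc d hd hcd]
  have A_subset : A ⊆ Metric.ball 0 (1 + η / 2) := by
    refine Set.iUnion₂_subset fun x hx => ?_
    apply Metric.ball_subset_ball'
    rw [dist_zero_right, hs x hx, add_comm]
  have I : (s.card : ENNReal) * ENNReal.ofReal ((η / 2) ^ k) * μ (Metric.ball 0 1) ≤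
      ENNReal.ofReal ((1 + η / 2) ^ k) * μ (Metric.ball 0 1) :=
    calc
      _ = μ A := by
        rw [hA, measure_biUnion_finset D fun c _ => measurableSet_ball]
        simp only [μ, Measure.addHaar_ball_of_pos _ _ δpos, finrank_euclideanSpace,
          Fintype.card_fin, Finset.sum_const, nsmul_eq_mul, mul_assoc]
      _ ≤ μ (Metric.ball 0 (1 + η / 2)) := measure_mono A_subset
      _ = _ := by
        simp only [μ, Measure.addHaar_ball_of_pos _ _ ρpos, finrank_euclideanSpace,
          Fintype.card_fin]
  have J := (ENNReal.mul_le_mul_iff_left (Metric.measure_ball_pos μ _ zero_lt_one).ne'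
    measure_ball_lt_top.ne).1 I
  have K := ENNReal.toReal_le_of_le_ofReal (by positivity) J
  rw [ENNReal.toReal_mul, ENNReal.toReal_natCast, ENNReal.toReal_ofReal (by positivity)] at K
  have e : 1 + 2 / η = (1 + η / 2) / (η / 2) := by field_simp; ring
  rw [e, div_pow, le_div_iff₀ (by positivity)]
  exact K

/-- The unit sphere of `ℝ^k` has an `η`-net with at most `(1 + 2/η)^k` elements. -/
lemma exists_net_sphere (k : ℕ) {η : ℝ} (hη : 0 < η) :
    ∃ s : Finset (EuclideanSpace ℝ (Fin k)), (∀ c ∈ s, ‖c‖ = 1) ∧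
      (s.card : ℝ) ≤ (1 + 2 / η) ^ k ∧ ∀ x, ‖x‖ = 1 → ∃ c ∈ s, ‖x - c‖ ≤ η := by
  classical
  let P : ℕ → Prop := fun m => ∃ s : Finset (EuclideanSpace ℝ (Fin k)), s.card = m ∧
    (∀ c ∈ s, ‖c‖ = 1) ∧ ∀ c ∈ s, ∀ d ∈ s, c ≠ d → η ≤ ‖c - d‖
  obtain ⟨b, hb⟩ := exists_nat_ge ((1 + 2 / η) ^ k)
  have hP0 : P 0 := ⟨∅, by simp⟩
  have hbd : ∀ m, P m → m ≤ b := by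
    rintro m ⟨s, rfl, h1, h2⟩
    exact_mod_cast (card_le_of_separated_sphere hη s h1 h2).trans hb
  obtain ⟨s, hsc, h1, h2⟩ := Nat.findGreatest_spec (P := P) (Nat.zero_le b) hP0
  refine ⟨s, h1, card_le_of_separated_sphere hη s h1 h2, fun x hx => ?_⟩
  by_contra! hcon
  have hxs : x ∉ s := fun hxs => by
    have := hcon x hxs
    simp at this
    linarith
  have hP : P (s.card + 1) := by
    refine ⟨insert x s, Finset.card_insert_of_notMem hxs, ?_, ?_⟩
    · intro c hc
      rcases Finset.mem_insert.1 hc with rfl | hc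
      exacts [hx, h1 c hc]
    · intro c hc d hd hcd
      rcases Finset.mem_insert.1 hc with rfl | hc' <;>
        rcases Finset.mem_insert.1 hd with rfl | hd'
      · exact absurd rfl hcd
      · exact (hcon d hd').le
      · rw [norm_sub_rev]; exact (hcon c hc').le
      · exact h2 c hc' d hd' hcd
  have := Nat.le_findGreatest (hbd _ hP) hP
  omega

/-- Subgaussian increments: one-sided version. -/
lemma measure_increment_ge {n k : ℕ} {u w : EuclideanSpace ℝ (Fin k)}
    (hu : ‖u‖ = 1) (hw : ‖w‖ = 1) {δ : ℝ} (hδ : ‖u - w‖ ≤ δ) (hδ2 : δ < 2) (hδ0 : 0 < δ)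
    {F : EuclideanSpace ℝ (Fin n) → ℝ} {L : NNReal} (hL : LipschitzWith L F) (hL0 : 0 < L)
    {t : ℝ} (ht : 0 < t) :
    gaussMatrix n k {g | t ≤ F (eucMulVec g w) - F (eucMulVec g u)} ≤
      ENNReal.ofReal (Real.exp (-(t ^ 2 / (5 * δ ^ 2 * L ^ 2)))) := by
  have hL0' : (0 : ℝ) < L := hL0
  by_cases huw : u = w
  · subst huw
    simp [ht.not_ge]
  set c : ℝ := inner ℝ u w with hc
  have hd2 : ‖u - w‖ ^ 2 = 2 - 2 * c := by
    rw [norm_sub_sq_real, hu, hw]; ring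
  have hpos : 0 < ‖u - w‖ := norm_pos_iff.2 (sub_ne_zero.2 huw)
  have hlt : ‖u - w‖ < 2 := hδ.trans_lt hδ2
  have hc1 : c < 1 := by nlinarith
  have hc2 : -1 < c := by nlinarith
  set α := Real.arccos c with hα
  have hcos : Real.cos α = c := Real.cos_arccos hc2.le hc1.le
  have hα0 : 0 < α := Real.arccos_pos.2 hc1
  have hαπ : α < Real.pi := by
    refine lt_of_le_of_ne (Real.arccos_le_pi _) fun h => ?_
    have := Real.arccos_eq_pi.1 h
    linarith
  have hsin : 0 < Real.sin α := Real.sin_pos_of_pos_of_lt_pi hα0 hαπ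
  have hsc : Real.sin α ^ 2 = 1 - c ^ 2 := by rw [← hcos]; exact Real.sin_sq α
  set v : EuclideanSpace ℝ (Fin k) := (Real.sin α)⁻¹ • (w - c • u) with hv
  have huv : inner ℝ u v = 0 := by
    rw [hv, inner_smul_right, inner_sub_right, inner_smul_right, real_inner_self_eq_norm_sq, hu]
    simp [hc]
  have hvn : ‖v‖ = 1 := by
    have h1 : ‖w - c • u‖ ^ 2 = Real.sin α ^ 2 := by
      rw [norm_sub_sq_real, inner_smul_right, real_inner_comm, ← hc, norm_smul, hu, hw, hsc,
        Real.norm_eq_abs, mul_one, sq_abs]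
      ring
    have h2 : ‖w - c • u‖ = Real.sin α := by
      rw [← abs_of_pos hsin, ← abs_of_nonneg (norm_nonneg (w - c • u))]
      exact sq_eq_sq_iff_abs_eq_abs _ _ |>.1 h1
    rw [hv, norm_smul, h2, norm_inv, Real.norm_eq_abs, abs_of_pos hsin, inv_mul_cancel₀ hsin.ne']
  have hw' : Real.cos α • u + Real.sin α • v = w := by
    rw [hv, hcos, smul_smul, mul_inv_cancel₀ hsin.ne']
    simp
  have key := measure_arc_increment_ge (n := n) hu hvn huv hL hL0 hα0 ht.le
  rw [hw'] at key
  refine key.trans (ENNReal.ofReal_le_ofReal (Real.exp_le_exp.2 (neg_le_neg ?_)))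
  refine div_le_div_of_nonneg_left (by positivity) (by positivity) ?_
  refine mul_le_mul_of_nonneg_right ?_ (by positivity)
  have hq := Real.cos_le_one_sub_mul_cos_sq (x := α) (by rw [abs_of_pos hα0]; exact hαπ.le)
  rw [hcos] at hq
  have h4 : 2 / Real.pi ^ 2 * α ^ 2 ≤ 1 - c := by linarith
  rw [div_mul_eq_mul_div, div_le_iff₀ (by positivity)] at h4
  have hπ : Real.pi ^ 2 < 10 := by nlinarith [Real.pi_lt_d2, Real.pi_pos]
  have h5 : ‖u - w‖ ^ 2 ≤ δ ^ 2 := pow_le_pow_left₀ hpos.le hδ 2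
  nlinarith

/-- Subgaussian increments: two-sided version. -/
lemma measure_abs_increment_ge {n k : ℕ} {u w : EuclideanSpace ℝ (Fin k)}
    (hu : ‖u‖ = 1) (hw : ‖w‖ = 1) {δ : ℝ} (hδ : ‖u - w‖ ≤ δ) (hδ2 : δ < 2) (hδ0 : 0 < δ)
    {F : EuclideanSpace ℝ (Fin n) → ℝ} {L : NNReal} (hL : LipschitzWith L F) (hL0 : 0 < L)
    {t : ℝ} (ht : 0 < t) :
    gaussMatrix n k {g | t ≤ |F (eucMulVec g w) - F (eucMulVec g u)|} ≤
      2 * ENNReal.ofReal (Real.exp (-(t ^ 2 / (5 * δ ^ 2 * L ^ 2)))) := by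
  have h1 := measure_increment_ge (n := n) hu hw hδ hδ2 hδ0 hL hL0 ht
  have h2 := measure_increment_ge (n := n) hw hu (norm_sub_rev u w ▸ hδ) hδ2 hδ0 hL hL0 ht
  rw [two_mul]
  refine (measure_mono ?_).trans ((measure_union_le _ _).trans (add_le_add h1 h2))
  intro g hg
  simp only [Set.mem_ofPred_eq, Set.mem_union] at hg ⊢
  rcases le_abs.1 hg with h | h
  · exact Or.inl h
  · right; linarith

/-- Gaussian concentration around a quantile. -/
lemma measure_stdGaussian_abs_sub_ge {n : ℕ} {F : EuclideanSpace ℝ (Fin n) → ℝ} {L : NNReal}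
    (hL : LipschitzWith L F) (hL0 : 0 < L) {m t : ℝ} (ht : 0 < t)
    (h1 : 1 / 4 ≤ _root_.stdGaussian n {y | F (WithLp.toLp 2 y) ≤ m})
    (h2 : 1 / 4 ≤ _root_.stdGaussian n {y | m ≤ F (WithLp.toLp 2 y)}) :
    _root_.stdGaussian n {y | t ≤ |F (WithLp.toLp 2 y) - m|} ≤
      8 * ENNReal.ofReal (Real.exp (-(t ^ 2 / (5 * L ^ 2)))) := by
  have hL0' : (0 : ℝ) < L := hL0
  set X : (Fin n → ℝ) → ℝ := fun y => F (WithLp.toLp 2 y) with hX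
  have hXc : Continuous X := hL.continuous.comp (by fun_prop)
  set E := ENNReal.ofReal (Real.exp (-(t ^ 2 / (5 * L ^ 2)))) with hE
  have hprod : ((_root_.stdGaussian n).prod (_root_.stdGaussian n))
      {z | t ≤ X z.2 - X z.1} ≤ E := by
    let u : EuclideanSpace ℝ (Fin 2) := EuclideanSpace.single 0 1
    let v : EuclideanSpace ℝ (Fin 2) := EuclideanSpace.single 1 1
    have hu : ‖u‖ = 1 := by simp [u]
    have hv : ‖v‖ = 1 := by simp [v]
    have huv : inner ℝ u v = 0 := by simp [u, v, EuclideanSpace.inner_single_left]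
    have key := measure_arc_increment_ge (n := n) hu hv huv hL hL0 Real.pi_div_two_pos ht.le
    rw [← map_gaussMatrix_of_orthonormal hu hv huv, Measure.map_apply
      ((measurable_mulVec _).prodMk (measurable_mulVec _))
      (measurableSet_le measurable_const (by fun_prop))]
    simp only [Real.cos_pi_div_two, Real.sin_pi_div_two, zero_smul, one_smul, zero_add] at key
    refine key.trans (ENNReal.ofReal_le_ofReal (Real.exp_le_exp.2 (neg_le_neg ?_)))
    refine div_le_div_of_nonneg_left (by positivity) (by positivity) ?_
    refine mul_le_mul_of_nonneg_right ?_ (by positivity)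
    nlinarith [Real.pi_lt_d2, Real.pi_pos]
  have hfour : ∀ a b : ENNReal, 1 / 4 ≤ a → a * b ≤ E → b ≤ 4 * E := by
    intro a b ha hab
    calc b = 4 * (1 / 4 * b) := by
          rw [← mul_assoc, ENNReal.mul_div_cancel (by norm_num) (by norm_num), one_mul]
      _ ≤ 4 * E := by gcongr; exact (by gcongr : 1 / 4 * b ≤ a * b).trans hab
  have hup : _root_.stdGaussian n {y | t ≤ X y - m} ≤ 4 * E := by
    refine hfour _ _ h1 ?_
    rw [← Measure.prod_prod]
    refine (measure_mono ?_).trans hprod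
    rintro ⟨a, b⟩ ⟨ha, hb⟩
    simp only [Set.mem_ofPred_eq] at ha hb ⊢
    linarith
  have hlo : _root_.stdGaussian n {y | t ≤ m - X y} ≤ 4 * E := by
    refine hfour _ _ h2 ?_
    rw [mul_comm, ← Measure.prod_prod]
    refine (measure_mono ?_).trans hprod
    rintro ⟨a, b⟩ ⟨ha, hb⟩
    simp only [Set.mem_ofPred_eq] at ha hb ⊢
    linarith
  have h8 : (8 : ENNReal) = 4 + 4 := by norm_num
  rw [h8, add_mul]
  refine (measure_mono ?_).trans ((measure_union_le _ _).trans (add_le_add hup hlo))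
  intro y hy
  simp only [Set.mem_ofPred_eq, Set.mem_union] at hy ⊢
  rcases le_abs.1 hy with h | h
  · exact Or.inl h
  · right; linarith

lemma exists_dyadic_nets (k : ℕ) : ∃ N : ℕ → Finset (EuclideanSpace ℝ (Fin k)),
    (∀ j, ∀ c ∈ N j, ‖c‖ = 1) ∧ (∀ j, ((N j).card : ℝ) ≤ Real.exp (k * (2 + j))) ∧
    ∀ j, ∀ x, ‖x‖ = 1 → ∃ c ∈ N j, ‖x - c‖ ≤ (1 / 2) ^ (j + 1) := by
  choose N h1 h2 h3 using fun j : ℕ => exists_net_sphere k (η := (1 / 2) ^ (j + 1)) (by positivity)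
  refine ⟨N, h1, fun j => (h2 j).trans ?_, h3⟩
  rw [Real.exp_nat_mul]
  refine pow_le_pow_left₀ (by positivity) ?_ k
  have e1 : 2 / (1 / 2 : ℝ) ^ (j + 1) = 4 * 2 ^ j := by
    rw [one_div, inv_pow, div_inv_eq_mul, pow_succ]; ring
  have e2 : (1 : ℝ) ≤ 2 ^ j := one_le_pow₀ (by norm_num)
  have e3 : (2 : ℝ) ^ j ≤ Real.exp j := by
    have : (2 : ℝ) ≤ Real.exp 1 := by linarith [Real.add_one_le_exp (1 : ℝ)]
    calc (2 : ℝ) ^ j ≤ Real.exp 1 ^ j := pow_le_pow_left₀ (by norm_num) this j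
      _ = Real.exp j := by rw [← Real.exp_nat_mul, mul_one]
  have e4 : (5 : ℝ) ≤ Real.exp 2 := by
    have : Real.exp 2 = Real.exp 1 * Real.exp 1 := by rw [← Real.exp_add]; norm_num
    rw [this]
    nlinarith [Real.exp_one_gt_d9]
  rw [e1, Real.exp_add]
  calc 1 + 4 * 2 ^ j ≤ 5 * (2 : ℝ) ^ j := by linarith
    _ ≤ _ := mul_le_mul e4 e3 (by positivity) (by positivity)

/-- Chaining bound: a Lipschitz function of a Gaussian matrix applied to unit vectors is uniformly
close to any quantile of the function of a single Gaussian vector. -/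
theorem measure_exists_abs_sub_gt {n k : ℕ} {F : EuclideanSpace ℝ (Fin n) → ℝ} {L : NNReal}
    (hL : LipschitzWith L F) (hL0 : 0 < L) {m q : ℝ} (hq : 1 ≤ q) (hk : (k : ℝ) ≤ q)
    (h1 : 1 / 4 ≤ _root_.stdGaussian n {y | F (WithLp.toLp 2 y) ≤ m})
    (h2 : 1 / 4 ≤ _root_.stdGaussian n {y | m ≤ F (WithLp.toLp 2 y)}) :
    gaussMatrix n k {g | ∃ x, ‖x‖ = 1 ∧ 40 * L * √q < |F (eucMulVec g x) - m|} ≤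
      10 * ENNReal.ofReal (Real.exp (-q)) := by
  have hL0' : (0 : ℝ) < L := hL0
  have hq0 : 0 < q := by linarith
  have hsq : √q ^ 2 = q := Real.sq_sqrt hq0.le
  have hsq0 : 0 < √q := Real.sqrt_pos.2 hq0
  obtain ⟨N, hN1, hNc, hN⟩ := exists_dyadic_nets k
  set T : ℝ := 8 * L * √q with hT
  have hT0 : 0 < T := by positivity
  have hcard : ∀ j : ℕ, ((N j).card : ENNReal) ≤ ENNReal.ofReal (Real.exp (q * (2 + j))) := by
    intro j
    rw [← ENNReal.ofReal_natCast]
    refine ENNReal.ofReal_le_ofReal ((hNc j).trans (Real.exp_le_exp.2 ?_))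
    gcongr
  set B0 : Set (Fin n → Fin k → ℝ) := ⋃ u ∈ N 0, {g | T ≤ |F (eucMulVec g u) - m|} with hB0
  set B : ℕ → Set (Fin n → Fin k → ℝ) := fun j => ⋃ u ∈ N j, ⋃ w ∈ N (j + 1),
    {g | ‖u - w‖ ≤ (1 / 2) ^ j ∧ T * (3 / 4) ^ j ≤ |F (eucMulVec g w) - F (eucMulVec g u)|} with hB
  set E := ENNReal.ofReal (Real.exp (-q)) with hE
  have hmB0 : gaussMatrix n k B0 ≤ 8 * E := by
    refine (measure_biUnion_finset_le _ _).trans ?_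
    calc ∑ u ∈ N 0, gaussMatrix n k {g | T ≤ |F (eucMulVec g u) - m|}
        ≤ ∑ u ∈ N 0, 8 * ENNReal.ofReal (Real.exp (-(T ^ 2 / (5 * L ^ 2)))) := by
          refine Finset.sum_le_sum fun u hu => ?_
          refine le_trans (le_of_eq ?_) (measure_stdGaussian_abs_sub_ge hL hL0 hT0 h1 h2)
          rw [← map_gaussMatrix_of_unit (k := k) (hN1 0 u hu),
            Measure.map_apply (measurable_mulVec _)]
          · rfl
          · refine measurableSet_le measurable_const (Continuous.measurable ?_)
            exact ((hL.continuous.comp (by fun_prop)).sub continuous_const).abs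
      _ = 8 * ((N 0).card * ENNReal.ofReal (Real.exp (-(T ^ 2 / (5 * L ^ 2))))) := by
          rw [Finset.sum_const, nsmul_eq_mul]; ring
      _ ≤ 8 * (ENNReal.ofReal (Real.exp (q * (2 + (0 : ℕ)))) *
            ENNReal.ofReal (Real.exp (-(T ^ 2 / (5 * L ^ 2))))) := by gcongr; exact hcard 0
      _ ≤ 8 * E := by
          rw [← ENNReal.ofReal_mul (Real.exp_pos _).le, ← Real.exp_add]
          refine mul_le_mul_right (ENNReal.ofReal_le_ofReal (Real.exp_le_exp.2 ?_)) _
          rw [hT, mul_pow, mul_pow, hsq]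
          have : 8 ^ 2 * (L : ℝ) ^ 2 * q / (5 * L ^ 2) = 64 / 5 * q := by field_simp; norm_num
          rw [this]
          push_cast
          linarith
  have hmB : ∀ j, gaussMatrix n k (B j) ≤ 2 * E * 2⁻¹ ^ (j + 1) := by
    intro j
    set e := ENNReal.ofReal (Real.exp (-(64 / 5 * q * (9 / 4) ^ j))) with he
    have hpair : ∀ u ∈ N j, ∀ w ∈ N (j + 1), gaussMatrix n k {g | ‖u - w‖ ≤ (1 / 2) ^ j ∧
        T * (3 / 4) ^ j ≤ |F (eucMulVec g w) - F (eucMulVec g u)|} ≤ 2 * e := by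
      intro u hu w hw
      by_cases hd : ‖u - w‖ ≤ (1 / 2) ^ j
      · have hlt : (1 / 2 : ℝ) ^ j < 2 :=
          lt_of_le_of_lt (pow_le_one₀ (by norm_num) (by norm_num)) (by norm_num)
        have := measure_abs_increment_ge (n := n) (hN1 _ u hu) (hN1 _ w hw) hd hlt
          (by positivity) hL hL0 (t := T * (3 / 4) ^ j) (by positivity)
        refine (measure_mono fun g hg => hg.2).trans (this.trans (le_of_eq ?_))
        rw [he]
        congr 4
        rw [hT, mul_pow, mul_pow, mul_pow, hsq]
        have e9 : ((9 : ℝ) / 4) ^ j = ((3 / 4) ^ j) ^ 2 / ((1 / 2) ^ j) ^ 2 := by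
          rw [← pow_mul, ← pow_mul, mul_comm, pow_mul, pow_mul, ← div_pow]; norm_num
        rw [e9]
        field_simp
        norm_num
      · simp only [hd, false_and, Set.ofPred_false, measure_empty, zero_le]
    calc gaussMatrix n k (B j) ≤ ∑ u ∈ N j, ∑ w ∈ N (j + 1), 2 * e :=
          (measure_biUnion_finset_le _ _).trans (Finset.sum_le_sum fun u hu =>
            (measure_biUnion_finset_le _ _).trans (Finset.sum_le_sum fun w hw => hpair u hu w hw))
      _ = 2 * ((N j).card * (N (j + 1)).card * e) := by
          simp only [Finset.sum_const, nsmul_eq_mul]; ring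
      _ ≤ 2 * (ENNReal.ofReal (Real.exp (q * (2 + j))) *
            ENNReal.ofReal (Real.exp (q * (2 + (j + 1 : ℕ)))) * e) := by
          gcongr
          exacts [hcard j, hcard (j + 1)]
      _ ≤ 2 * (E * ENNReal.ofReal ((2⁻¹) ^ (j + 1))) := by
          rw [he, hE, ← ENNReal.ofReal_mul (Real.exp_pos _).le, ← Real.exp_add,
            ← ENNReal.ofReal_mul (Real.exp_pos _).le, ← Real.exp_add,
            ← ENNReal.ofReal_mul (Real.exp_pos _).le]
          gcongr
          have hb : 1 + (j : ℝ) * (5 / 4) ≤ (9 / 4) ^ j := by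
            have := one_add_mul_le_pow (a := (5 / 4 : ℝ)) (by norm_num) j
            norm_num at this ⊢
            linarith
          have h3 : Real.exp (-(j + 1)) ≤ (2 : ℝ)⁻¹ ^ (j + 1) := by
            have : (2 : ℝ) ≤ Real.exp 1 := by linarith [Real.add_one_le_exp (1 : ℝ)]
            rw [Real.exp_neg, inv_pow]
            refine inv_anti₀ (by positivity) ?_
            calc (2 : ℝ) ^ (j + 1) ≤ Real.exp 1 ^ (j + 1) := pow_le_pow_left₀ (by norm_num) this _
              _ = _ := by rw [← Real.exp_nat_mul, mul_one]; push_cast; rfl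
          refine le_trans ?_ (mul_le_mul_of_nonneg_left h3 (Real.exp_pos _).le)
          rw [← Real.exp_add, Real.exp_le_exp]
          push_cast
          have hj : (0 : ℝ) ≤ j := by positivity
          have h5 : q * (1 + j * (5 / 4)) ≤ q * (9 / 4) ^ j := by gcongr
          nlinarith [mul_nonneg hq0.le hj]
      _ = 2 * E * 2⁻¹ ^ (j + 1) := by
          rw [ENNReal.ofReal_pow (by norm_num), ENNReal.ofReal_inv_of_pos (by norm_num),
            ENNReal.ofReal_ofNat, mul_assoc]
  have hU : gaussMatrix n k (⋃ j, B j) ≤ 2 * E := by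
    refine (measure_iUnion_le _).trans ((ENNReal.tsum_le_tsum hmB).trans (le_of_eq ?_))
    rw [ENNReal.tsum_mul_left, ENNReal.tsum_geometric_add_one, ENNReal.one_sub_inv_two, inv_inv,
      ENNReal.inv_mul_cancel (by norm_num) (by norm_num), mul_one]
  have hsub : {g | ∃ x, ‖x‖ = 1 ∧ 40 * L * √q < |F (eucMulVec g x) - m|} ⊆ B0 ∪ ⋃ j, B j := by
    intro g hg
    by_contra hgn
    obtain ⟨x, hx, hgt⟩ := hg
    simp only [hB0, hB, Set.mem_union, Set.mem_iUnion, Set.mem_ofPred_eq, not_or, not_exists,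
      not_and, not_le] at hgn
    obtain ⟨hg0, hgj⟩ := hgn
    choose c hc hxc using fun j => hN j x hx
    have hstep : ∀ j, |F (eucMulVec g (c (j + 1))) - F (eucMulVec g (c j))| ≤ T * (3 / 4) ^ j := by
      intro j
      refine (hgj j (c j) (hc j) (c (j + 1)) (hc (j + 1)) ?_).le
      have ha := hxc j
      have hb := hxc (j + 1)
      have : c j - c (j + 1) = (x - c (j + 1)) - (x - c j) := by abel
      rw [this]
      refine (norm_sub_le _ _).trans ?_
      have hp : (0 : ℝ) < (1 / 2) ^ j := by positivity
      rw [pow_succ] at ha hb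
      rw [pow_succ] at hb
      linarith
    have hall : ∀ J : ℕ, |F (eucMulVec g (c J)) - m| ≤ T * (5 - 4 * (3 / 4) ^ J) := by
      intro J
      induction J with
      | zero => norm_num; exact (hg0 _ (hc 0)).le
      | succ J ih =>
        have := abs_add_le (F (eucMulVec g (c (J + 1))) - F (eucMulVec g (c J)))
          (F (eucMulVec g (c J)) - m)
        rw [sub_add_sub_cancel] at this
        refine this.trans ((add_le_add (hstep J) ih).trans (le_of_eq ?_))
        rw [pow_succ]; ring
    have hlimc : Filter.Tendsto c Filter.atTop (nhds x) := by
      rw [tendsto_iff_norm_sub_tendsto_zero]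
      refine squeeze_zero (fun _ => norm_nonneg _) (fun j => (norm_sub_rev _ _).le.trans (hxc j)) ?_
      exact (tendsto_pow_atTop_nhds_zero_of_lt_one (by norm_num) (by norm_num : (1 / 2 : ℝ) < 1)
        ).comp (Filter.tendsto_add_atTop_nat 1)
    have hcont : Continuous fun x => |F (eucMulVec g x) - m| :=
      ((hL.continuous.comp (continuous_eucMulVec.comp (by fun_prop :
        Continuous fun x : EuclideanSpace ℝ (Fin k) => (g, x)))).sub continuous_const).abs
    have hle : |F (eucMulVec g x) - m| ≤ T * 5 := by
      refine le_of_tendsto ((hcont.tendsto x).comp hlimc) (Filter.Eventually.of_forall fun J => ?_)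
      refine (hall J).trans (mul_le_mul_of_nonneg_left ?_ hT0.le)
      have : (0 : ℝ) < (3 / 4) ^ J := by positivity
      linarith
    rw [hT] at hle
    linarith
  calc _ ≤ gaussMatrix n k B0 + gaussMatrix n k (⋃ j, B j) :=
        (measure_mono hsub).trans (measure_union_le _ _)
    _ ≤ 8 * E + 2 * E := add_le_add hmB0 hU
    _ = _ := by rw [← add_mul]; norm_num

/-- Exponential Markov inequality for sums over the coordinates of a Gaussian vector. -/
lemma measure_stdGaussian_sum_ge {n : ℕ} {h : ℝ → ℝ} {b s : ℝ}
    (hi : Integrable (fun x => Real.exp (h x)) (gaussianReal 0 1))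
    (hb : ∫ x, Real.exp (h x) ∂(gaussianReal 0 1) ≤ b) :
    _root_.stdGaussian n {y | s ≤ ∑ i, h (y i)} ≤ ENNReal.ofReal (b ^ n * Real.exp (-s)) := by
  have h_int : Integrable (fun y : Fin n → ℝ => ∏ i, Real.exp (h (y i))) (_root_.stdGaussian n) :=
    Integrable.fintype_prod fun _ => hi
  have hval : ∫ y : Fin n → ℝ, ∏ i, Real.exp (h (y i)) ∂(_root_.stdGaussian n) =
      (∫ x, Real.exp (h x) ∂(gaussianReal 0 1)) ^ n := by
    have := integral_fintype_prod_eq_pow (ι := Fin n) (μ := gaussianReal 0 1)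
      (fun x => Real.exp (h x))
    rwa [Fintype.card_fin] at this
  have hM := mul_meas_ge_le_integral_of_nonneg (μ := _root_.stdGaussian n)
    (Filter.Eventually.of_forall fun y => by positivity) h_int (Real.exp s)
  rw [hval] at hM
  have h0 : 0 ≤ ∫ x, Real.exp (h x) ∂(gaussianReal 0 1) :=
    integral_nonneg fun x => (Real.exp_pos _).le
  have hM2 := hM.trans (pow_le_pow_left₀ h0 hb n)
  have hset : {y : Fin n → ℝ | s ≤ ∑ i, h (y i)} =
      {y | Real.exp s ≤ ∏ i, Real.exp (h (y i))} := by
    ext y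
    simp only [Set.mem_ofPred_eq]
    rw [← Real.exp_sum, Real.exp_le_exp]
  rw [hset, ← ofReal_measureReal]
  refine ENNReal.ofReal_le_ofReal ?_
  rw [Real.exp_neg, ← div_eq_mul_inv, le_div_iff₀ (Real.exp_pos _), mul_comm]
  exact hM2

lemma integrable_exp_sq_div_four :
    Integrable (fun x : ℝ => Real.exp (x ^ 2 / 4)) (gaussianReal 0 1) := by
  rw [gaussianReal_of_var_ne_zero _ one_ne_zero, gaussianPDF_def,
    integrable_withDensity_iff_integrable_smul' (by fun_prop) (by simp)]
  have : (fun x : ℝ => (ENNReal.ofReal (gaussianPDFReal 0 1 x)).toReal • Real.exp (x ^ 2 / 4)) =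
      fun x => (√(2 * Real.pi))⁻¹ * Real.exp (-(1 / 4) * x ^ 2) := by
    ext x
    rw [ENNReal.toReal_ofReal (gaussianPDFReal_nonneg _ _ _), gaussianPDFReal, smul_eq_mul,
      mul_assoc, ← Real.exp_add]
    congr 2
    · simp
    · simp; ring
  rw [this]
  exact (integrable_exp_neg_mul_sq (by norm_num)).const_mul _

lemma integral_exp_sq_div_four :
    ∫ x : ℝ, Real.exp (x ^ 2 / 4) ∂(gaussianReal 0 1) = √2 := by
  rw [integral_gaussianReal_eq_integral_smul one_ne_zero]
  have : (fun x : ℝ => gaussianPDFReal 0 1 x • Real.exp (x ^ 2 / 4)) =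
      fun x => (√(2 * Real.pi))⁻¹ * Real.exp (-(1 / 4) * x ^ 2) := by
    ext x
    rw [gaussianPDFReal, smul_eq_mul, mul_assoc, ← Real.exp_add]
    congr 2
    · simp
    · simp; ring
  rw [this, integral_const_mul, integral_gaussian, ← Real.sqrt_inv, ← Real.sqrt_mul (by positivity)]
  congr 1
  field_simp
  norm_num

lemma integrable_exp_excess (τ : ℝ) :
    Integrable (fun x : ℝ => Real.exp (max (x ^ 2 - τ) 0 / 4)) (gaussianReal 0 1) := by
  have h2 : Integrable (fun x : ℝ => 1 + Real.exp (-(τ / 4)) * Real.exp (x ^ 2 / 4))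
      (gaussianReal 0 1) := (integrable_const 1).add (integrable_exp_sq_div_four.const_mul _)
  refine h2.mono' (by fun_prop) (Filter.Eventually.of_forall fun x => ?_)
  rw [Real.norm_eq_abs, abs_of_pos (Real.exp_pos _), ← Real.exp_add]
  rcases max_cases (x ^ 2 - τ) 0 with ⟨h, -⟩ | ⟨h, -⟩ <;> rw [h]
  · have : (x ^ 2 - τ) / 4 = -(τ / 4) + x ^ 2 / 4 := by ring
    rw [this]; linarith
  · simp [Real.exp_nonneg]

lemma integral_exp_excess_le (τ : ℝ) :
    ∫ x : ℝ, Real.exp (max (x ^ 2 - τ) 0 / 4) ∂(gaussianReal 0 1) ≤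
      1 + 2 * Real.exp (-(τ / 4)) := by
  have h2 : Integrable (fun x : ℝ => 1 + Real.exp (-(τ / 4)) * Real.exp (x ^ 2 / 4))
      (gaussianReal 0 1) := (integrable_const 1).add (integrable_exp_sq_div_four.const_mul _)
  calc _ ≤ ∫ x : ℝ, (1 + Real.exp (-(τ / 4)) * Real.exp (x ^ 2 / 4)) ∂(gaussianReal 0 1) := by
        refine integral_mono (integrable_exp_excess τ) h2 fun x => ?_
        simp only
        rw [← Real.exp_add]
        rcases max_cases (x ^ 2 - τ) 0 with ⟨h, -⟩ | ⟨h, -⟩ <;> rw [h]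
        · have : (x ^ 2 - τ) / 4 = -(τ / 4) + x ^ 2 / 4 := by ring
          rw [this]; linarith
        · simp [Real.exp_nonneg]
    _ = 1 + Real.exp (-(τ / 4)) * √2 := by
        rw [integral_add (integrable_const 1) (integrable_exp_sq_div_four.const_mul _),
          integral_const_mul, integral_exp_sq_div_four]
        simp
    _ ≤ _ := by
        have : √2 ≤ 2 := by
          rw [Real.sqrt_le_left (by norm_num)]; norm_num
        nlinarith [Real.exp_pos (-(τ / 4))]

/-- `ψ_n(m) = m log(en/m)`, the order of the largest sum of `m` squares among `n` Gaussians. -/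
noncomputable def topEntropy (n m : ℕ) : ℝ := m * (1 + Real.log (n / m))

lemma le_topEntropy {n m : ℕ} (hmn : m ≤ n) : (m : ℝ) ≤ topEntropy n m := by
  unfold topEntropy
  rcases Nat.eq_zero_or_pos m with rfl | hm
  · simp
  have : (0 : ℝ) < m := by exact_mod_cast hm
  have h1 : 0 ≤ Real.log (n / m) :=
    Real.log_nonneg (by rw [le_div_iff₀ this, one_mul]; exact_mod_cast hmn)
  nlinarith

lemma one_add_log_le_topEntropy {n m : ℕ} (hm : 1 ≤ m) (hmn : m ≤ n) :
    1 + Real.log n ≤ topEntropy n m := by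
  unfold topEntropy
  have hm0 : (1 : ℝ) ≤ m := by exact_mod_cast hm
  have hn0 : (0 : ℝ) < n := by exact_mod_cast (hm.trans hmn)
  have h1 : 0 ≤ Real.log (n / m) :=
    Real.log_nonneg (by rw [le_div_iff₀ (by linarith), one_mul]; exact_mod_cast hmn)
  have h2 : Real.log n = Real.log m + Real.log (n / m) := by
    rw [Real.log_div hn0.ne' (by linarith)]; ring
  have h3 := Real.log_le_sub_one_of_pos (by linarith : (0 : ℝ) < m)
  nlinarith

/-- Partial sums of the squares of the coordinates of `y` are at most `C (ψ_n(m) + q)`. -/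
def SqBounded (C q : ℝ) {n : ℕ} (y : Fin n → ℝ) : Prop :=
  ∀ I : Finset (Fin n), I.Nonempty → ∑ i ∈ I, y i ^ 2 ≤ C * (topEntropy n I.card + q)

lemma measure_not_sqBounded {n : ℕ} (q : ℝ) :
    _root_.stdGaussian n {y | ¬ SqBounded 12 q y} ≤ ENNReal.ofReal (Real.exp (-3 * q - 1)) := by
  rcases Nat.eq_zero_or_pos n with rfl | hn
  · have : {y : Fin 0 → ℝ | ¬ SqBounded 12 q y} = ∅ := by
      ext y
      simp only [Set.mem_ofPred_eq, Set.mem_empty_iff_false, iff_false, not_not]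
      intro I hI
      obtain ⟨i, -⟩ := hI
      exact i.elim0
    rw [this]; simp
  have hn0 : (0 : ℝ) < n := by exact_mod_cast hn
  set τ : ℕ → ℝ := fun m => 4 * (1 + Real.log (n / m)) with hτ
  set s : ℕ → ℝ := fun m => 2 * topEntropy n m + 3 * q with hs
  have hsub : {y : Fin n → ℝ | ¬ SqBounded 12 q y} ⊆
      ⋃ m ∈ Finset.Icc 1 n, {y | s m ≤ ∑ i, max (y i ^ 2 - τ m) 0 / 4} := by
    intro y hy
    simp only [SqBounded, Set.mem_ofPred_eq, not_forall, not_le] at hy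
    obtain ⟨I, hI, hlt⟩ := hy
    have hc1 : 1 ≤ I.card := hI.card_pos
    have hc2 : I.card ≤ n := by simpa using I.card_le_univ
    simp only [Set.mem_iUnion, Finset.mem_Icc, Set.mem_ofPred_eq]
    refine ⟨I.card, ⟨hc1, hc2⟩, ?_⟩
    have h1 : ∑ i ∈ I, y i ^ 2 ≤ ∑ i ∈ I, (τ I.card + max (y i ^ 2 - τ I.card) 0) :=
      Finset.sum_le_sum fun i _ => by linarith [le_max_left (y i ^ 2 - τ I.card) 0]
    rw [Finset.sum_add_distrib, Finset.sum_const, nsmul_eq_mul] at h1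
    have h2 : ∑ i ∈ I, max (y i ^ 2 - τ I.card) 0 ≤ ∑ i, max (y i ^ 2 - τ I.card) 0 :=
      Finset.sum_le_sum_of_subset_of_nonneg (Finset.subset_univ _) fun i _ _ => le_max_right _ _
    rw [← Finset.sum_div, le_div_iff₀ (by norm_num)]
    have h3 : (I.card : ℝ) * τ I.card = 4 * topEntropy n I.card := by
      simp only [hτ, topEntropy]; ring
    simp only [hs]
    linarith
  refine (measure_mono hsub).trans ((measure_biUnion_finset_le _ _).trans ?_)
  calc ∑ m ∈ Finset.Icc 1 n, _root_.stdGaussian n {y | s m ≤ ∑ i, max (y i ^ 2 - τ m) 0 / 4}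
      ≤ ∑ m ∈ Finset.Icc 1 n, ENNReal.ofReal (Real.exp (-3 * q - 1) / n) := by
        refine Finset.sum_le_sum fun m hm => ?_
        obtain ⟨hm1, hm2⟩ := Finset.mem_Icc.1 hm
        have hm0 : (0 : ℝ) < m := by exact_mod_cast hm1
        refine (measure_stdGaussian_sum_ge (integrable_exp_excess (τ m))
          (integral_exp_excess_le (τ m))).trans (ENNReal.ofReal_le_ofReal ?_)
        have e1 : Real.exp (-(τ m / 4)) = Real.exp (-1) * (m / n) := by
          have : -(τ m / 4) = -1 + Real.log (m / n) := by
            have : Real.log (m / n) = - Real.log (n / m) := by rw [← Real.log_inv, inv_div]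
            simp only [hτ]
            rw [this]; ring
          rw [this, Real.exp_add, Real.exp_log (by positivity)]
        have e2 : 2 * Real.exp (-1) ≤ 1 := by
          rw [Real.exp_neg, ← div_eq_mul_inv, div_le_one (Real.exp_pos _)]
          linarith [Real.add_one_le_exp (1 : ℝ)]
        have e3 : (1 + 2 * Real.exp (-(τ m / 4))) ^ n ≤ Real.exp m := by
          have : 1 + 2 * Real.exp (-(τ m / 4)) ≤ Real.exp (m / n) := by
            rw [e1]
            have h5 : (0 : ℝ) ≤ m / n := by positivity
            nlinarith [Real.add_one_le_exp ((m : ℝ) / n)]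
          refine (pow_le_pow_left₀ (by positivity) this n).trans (le_of_eq ?_)
          rw [← Real.exp_nat_mul]
          congr 1
          field_simp
        refine (mul_le_mul_of_nonneg_right e3 (Real.exp_pos _).le).trans ?_
        have e4 : Real.exp (-3 * q - 1) / n = Real.exp (-3 * q - 1 - Real.log n) := by
          rw [Real.exp_sub _ (Real.log n), Real.exp_log hn0]
        rw [e4, ← Real.exp_add, Real.exp_le_exp]
        have := le_topEntropy hm2
        have := one_add_log_le_topEntropy hm1 hm2
        simp only [hs]
        linarith
    _ = _ := by
        rw [Finset.sum_const, Nat.card_Icc, Nat.add_sub_cancel, nsmul_eq_mul,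
          ← ENNReal.ofReal_natCast, ← ENNReal.ofReal_mul (by positivity)]
        congr 1
        field_simp

/-- The square bounds hold uniformly on the sphere. -/
theorem measure_exists_not_sqBounded {n k : ℕ} {q : ℝ} (hq : 1 ≤ q) (hk : (k : ℝ) ≤ q) :
    gaussMatrix n k {g | ∃ x : EuclideanSpace ℝ (Fin k), ‖x‖ = 1 ∧
      ¬ SqBounded 48 q (mulVec g x.ofLp)} ≤ ENNReal.ofReal (Real.exp (-q)) := by
  obtain ⟨N, hN1, hNc, hN⟩ := exists_net_sphere k (η := 1 / 2) (by norm_num)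
  have hsub : {g : Fin n → Fin k → ℝ | ∃ x : EuclideanSpace ℝ (Fin k), ‖x‖ = 1 ∧
      ¬ SqBounded 48 q (mulVec g x.ofLp)} ⊆
      ⋃ c ∈ N, {g | ¬ SqBounded 12 q (mulVec g c.ofLp)} := by
    intro g hg
    by_contra hcon
    simp only [Set.mem_iUnion, Set.mem_ofPred_eq, not_exists, not_not] at hcon
    obtain ⟨x, hx, hnot⟩ := hg
    refine hnot fun I hI => ?_
    set R := √(12 * (topEntropy n I.card + q)) with hR
    have hR0 : 0 ≤ 12 * (topEntropy n I.card + q) := by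
      have := le_topEntropy (n := n) (m := I.card) (by simpa using I.card_le_univ)
      have : (0 : ℝ) ≤ I.card := by positivity
      linarith
    let A0 : EuclideanSpace ℝ (Fin k) →ₗ[ℝ] EuclideanSpace ℝ (Fin n) :=
      { toFun := fun z => WithLp.toLp 2 fun i => if i ∈ I then eucMulVec g z i else 0
        map_add' := fun a b => by
          ext i; by_cases h : i ∈ I <;> simp [h, eucMulVec_add]
        map_smul' := fun a b => by
          ext i; by_cases h : i ∈ I <;> simp [h, eucMulVec_smul] }
    let A := A0.toContinuousLinearMap
    have hA : ∀ z, ‖A z‖ ^ 2 = ∑ i ∈ I, mulVec g z.ofLp i ^ 2 := by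
      intro z
      rw [EuclideanSpace.norm_sq_eq]
      simp only [A, A0, LinearMap.coe_toContinuousLinearMap', LinearMap.coe_mk, AddHom.coe_mk,
        Real.norm_eq_abs, sq_abs, ite_pow]
      simp [eucMulVec, Finset.sum_ite_mem]
    have hAN : ∀ c ∈ N, ‖A c‖ ≤ R := by
      intro c hc
      refine Real.le_sqrt_of_sq_le ?_
      rw [hA]
      exact hcon c hc I hI
    have hop : ‖A‖ ≤ R + ‖A‖ * (1 / 2) := by
      refine A.opNorm_le_bound (by positivity) fun z => ?_
      rcases eq_or_ne z 0 with rfl | hz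
      · simp
      have hz0 : 0 < ‖z‖ := norm_pos_iff.2 hz
      obtain ⟨c, hc, hzc⟩ := hN (‖z‖⁻¹ • z) (by
        rw [norm_smul, norm_inv, norm_norm, inv_mul_cancel₀ hz0.ne'])
      have h1 : ‖A (‖z‖⁻¹ • z)‖ ≤ R + ‖A‖ * (1 / 2) := by
        have e : ‖z‖⁻¹ • z = c + (‖z‖⁻¹ • z - c) := by abel
        rw [e, map_add]
        refine (norm_add_le _ _).trans (add_le_add (hAN c hc) ((A.le_opNorm _).trans ?_))
        gcongr
      rw [map_smul, norm_smul, norm_inv, norm_norm, inv_mul_le_iff₀ hz0] at h1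
      linarith
    have hA2 : ‖A x‖ ≤ 2 * R := by
      have := A.le_opNorm x
      rw [hx, mul_one] at this
      linarith
    rw [← hA]
    calc ‖A x‖ ^ 2 ≤ (2 * R) ^ 2 := pow_le_pow_left₀ (norm_nonneg _) hA2 2
      _ = 48 * (topEntropy n I.card + q) := by rw [mul_pow, hR, Real.sq_sqrt hR0]; ring
  refine (measure_mono hsub).trans ((measure_biUnion_finset_le _ _).trans ?_)
  calc ∑ c ∈ N, gaussMatrix n k {g | ¬ SqBounded 12 q (mulVec g c.ofLp)}
      ≤ ∑ c ∈ N, ENNReal.ofReal (Real.exp (-3 * q - 1)) := by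
        refine Finset.sum_le_sum fun c hc => ?_
        refine le_trans ?_ (measure_not_sqBounded (n := n) q)
        rw [← map_gaussMatrix_of_unit (n := n) (hN1 c hc)]
        exact Measure.le_map_apply (measurable_mulVec _).aemeasurable _
    _ = N.card * ENNReal.ofReal (Real.exp (-3 * q - 1)) := by
        rw [Finset.sum_const, nsmul_eq_mul]
    _ ≤ ENNReal.ofReal (Real.exp (2 * q)) * ENNReal.ofReal (Real.exp (-3 * q - 1)) := by
        gcongr
        rw [← ENNReal.ofReal_natCast]
        refine ENNReal.ofReal_le_ofReal (hNc.trans ?_)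
        have e4 : (1 + 2 / (1 / 2) : ℝ) ≤ Real.exp 2 := by
          have : Real.exp 2 = Real.exp 1 * Real.exp 1 := by rw [← Real.exp_add]; norm_num
          rw [this]
          nlinarith [Real.exp_one_gt_d9]
        refine (pow_le_pow_left₀ (by norm_num) e4 k).trans ?_
        rw [← Real.exp_nat_mul, Real.exp_le_exp]
        linarith
    _ ≤ _ := by
        rw [← ENNReal.ofReal_mul (Real.exp_pos _).le, ← Real.exp_add]
        refine ENNReal.ofReal_le_ofReal (Real.exp_le_exp.2 ?_)
        linarith

/-- The permutation sorting the coordinates of `x` by decreasing absolute value. -/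
noncomputable def decPerm {n : ℕ} (x : Fin n → ℝ) : Equiv.Perm (Fin n) :=
  Fin.revPerm.trans (Tuple.sort fun j => |x j|)

lemma decRe_eq {n : ℕ} (x : Fin n → ℝ) (i : Fin n) : decRe x i = |x (decPerm x i)| := rfl

lemma decRe_nonneg {n : ℕ} (x : Fin n → ℝ) (i : Fin n) : 0 ≤ decRe x i := abs_nonneg _

lemma decRe_antitone {n : ℕ} (x : Fin n → ℝ) : Antitone (decRe x) := fun _ _ h =>
  Tuple.monotone_sort (fun j => |x j|) (Fin.rev_le_rev.2 h)

/-- The `p`-th power of the Lorentz norm. -/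
noncomputable def lorSum {n : ℕ} (r p : ℝ) (x : Fin n → ℝ) : ℝ :=
  ∑ i : Fin n, ((i : ℝ) + 1) ^ (-r) * decRe x i ^ p

lemma lorNorm_eq {n : ℕ} (r p : ℝ) (x : Fin n → ℝ) : lorNorm r p x = lorSum r p x ^ (1 / p) := rfl

lemma lorSum_nonneg {n : ℕ} (r p : ℝ) (x : Fin n → ℝ) : 0 ≤ lorSum r p x :=
  Finset.sum_nonneg fun i _ => mul_nonneg (by positivity) (Real.rpow_nonneg (decRe_nonneg _ _) _)

lemma lorNorm_nonneg {n : ℕ} (r p : ℝ) (x : Fin n → ℝ) : 0 ≤ lorNorm r p x :=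
  Real.rpow_nonneg (lorSum_nonneg _ _ _) _

lemma lorNorm_rpow {n : ℕ} {r p : ℝ} (hp : 1 ≤ p) (x : Fin n → ℝ) :
    lorNorm r p x ^ p = lorSum r p x := by
  rw [lorNorm_eq, ← Real.rpow_mul (lorSum_nonneg _ _ _), one_div, inv_mul_cancel₀ (by linarith),
    Real.rpow_one]

/-- Rearrangement inequality. -/
lemma sum_perm_le_lorSum {n : ℕ} {r p : ℝ} (hr : 0 ≤ r) (hp : 0 ≤ p) (x : Fin n → ℝ)
    (τ : Equiv.Perm (Fin n)) :
    ∑ i : Fin n, ((i : ℝ) + 1) ^ (-r) * |x (τ i)| ^ p ≤ lorSum r p x := by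
  have hw : Antitone fun i : Fin n => ((i : ℝ) + 1) ^ (-r) := by
    intro a b hab
    refine Real.rpow_le_rpow_of_nonpos (by positivity) ?_ (by linarith)
    have : (a : ℝ) ≤ b := by exact_mod_cast hab
    linarith
  have hd : Antitone fun i : Fin n => decRe x i ^ p := fun a b hab =>
    Real.rpow_le_rpow (decRe_nonneg _ _) (decRe_antitone x hab) hp
  have hm := (hw.monovary hd).sum_mul_comp_perm_le_sum_mul (σ := τ.trans (decPerm x).symm)
  refine le_trans (le_of_eq ?_) hm
  simp [decRe_eq]

lemma lorNorm_smul {n : ℕ} {r p : ℝ} (hr : 0 ≤ r) (hp : 1 ≤ p) {c : ℝ} (hc : 0 ≤ c)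
    (x : Fin n → ℝ) : lorNorm r p (c • x) = c * lorNorm r p x := by
  have hp0 : 0 < p := by linarith
  have key : lorSum r p (c • x) = c ^ p * lorSum r p x := by
    have e : ∀ τ : Equiv.Perm (Fin n), ∑ i : Fin n, ((i : ℝ) + 1) ^ (-r) * |(c • x) (τ i)| ^ p =
        c ^ p * ∑ i : Fin n, ((i : ℝ) + 1) ^ (-r) * |x (τ i)| ^ p := by
      intro τ
      rw [Finset.mul_sum]
      refine Finset.sum_congr rfl fun i _ => ?_
      rw [Pi.smul_apply, smul_eq_mul, abs_mul, abs_of_nonneg hc,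
        Real.mul_rpow hc (abs_nonneg _)]
      ring
    apply le_antisymm
    · refine (e (decPerm (c • x))).le.trans ?_
      exact mul_le_mul_of_nonneg_left (sum_perm_le_lorSum hr hp0.le x _) (by positivity)
    · refine (e (decPerm x)).ge.trans (sum_perm_le_lorSum hr hp0.le _ _)
  rw [lorNorm_eq, lorNorm_eq, key, Real.mul_rpow (by positivity) (lorSum_nonneg _ _ _),
    ← Real.rpow_mul hc, mul_one_div_cancel hp0.ne', Real.rpow_one]

/-- Convexity bound for powers. -/
lemma rpow_sub_rpow_le {a b p : ℝ} (ha : 0 ≤ a) (hb : 0 ≤ b) (hp : 1 ≤ p) :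
    a ^ p - b ^ p ≤ p * a ^ (p - 1) * (a - b) := by
  rcases ha.eq_or_lt with rfl | ha
  · rcases hp.eq_or_lt with rfl | hp
    · simp
    · rw [Real.zero_rpow (by linarith), Real.zero_rpow (by linarith)]
      have := Real.rpow_nonneg hb p
      linarith
  have h := one_add_mul_self_le_rpow_one_add (s := b / a - 1) (by
    have : 0 ≤ b / a := by positivity
    linarith) hp
  rw [add_sub_cancel, Real.div_rpow hb ha.le, le_div_iff₀ (by positivity)] at h
  have e : a ^ p = a ^ (p - 1) * a := by rw [Real.rpow_sub_one ha.ne']; field_simp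
  have e2 : p * (b / a - 1) * a ^ p = p * a ^ (p - 1) * (b - a) := by rw [e]; field_simp
  nlinarith

/-- The squared Euclidean norm of the gradient of `lorSum r p / p`. -/
noncomputable def gradSq {n : ℕ} (r p : ℝ) (x : Fin n → ℝ) : ℝ :=
  ∑ i : Fin n, (((i : ℝ) + 1) ^ (-r) * decRe x i ^ (p - 1)) ^ 2

lemma lorSum_sub_le {n : ℕ} {r p : ℝ} (hr : 0 ≤ r) (hp : 1 ≤ p)
    (x y : EuclideanSpace ℝ (Fin n)) :
    lorSum r p x.ofLp - lorSum r p y.ofLp ≤ p * √(gradSq r p x.ofLp) * ‖x - y‖ := by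
  set σ := decPerm x.ofLp
  have h1 := sum_perm_le_lorSum hr (by linarith : 0 ≤ p) y.ofLp σ
  have h2 : lorSum r p x.ofLp - lorSum r p y.ofLp ≤
      ∑ i : Fin n, p * (((i : ℝ) + 1) ^ (-r) * decRe x.ofLp i ^ (p - 1) * |(x - y) (σ i)|) := by
    refine (sub_le_sub_left h1 _).trans ?_
    rw [lorSum, ← Finset.sum_sub_distrib]
    refine Finset.sum_le_sum fun i _ => ?_
    have h3 := rpow_sub_rpow_le (decRe_nonneg x.ofLp i) (abs_nonneg (y.ofLp (σ i))) hp
    have h4 : decRe x.ofLp i - |y.ofLp (σ i)| ≤ |(x - y) (σ i)| := by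
      rw [decRe_eq]; exact abs_sub_abs_le_abs_sub _ _
    have h5 : 0 ≤ p * decRe x.ofLp i ^ (p - 1) :=
      mul_nonneg (by linarith) (Real.rpow_nonneg (decRe_nonneg _ _) _)
    have h6 := h3.trans (mul_le_mul_of_nonneg_left h4 h5)
    have h7 : (0 : ℝ) ≤ ((i : ℝ) + 1) ^ (-r) := by positivity
    nlinarith [mul_le_mul_of_nonneg_left h6 h7]
  refine h2.trans ?_
  rw [← Finset.mul_sum, mul_assoc]
  refine mul_le_mul_of_nonneg_left ?_ (by linarith)
  refine (Real.sum_mul_le_sqrt_mul_sqrt _ _ _).trans (le_of_eq ?_)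
  congr 1
  rw [EuclideanSpace.norm_eq]
  congr 1
  simp only [Real.norm_eq_abs]
  exact Equiv.sum_comp σ (fun j => |(x - y) j| ^ 2)

/-- If the gradient is bounded on a set, then `lorSum` is Lipschitz on it. -/
lemma lipschitzOnWith_lorSum {n : ℕ} {r p : ℝ} (hr : 0 ≤ r) (hp : 1 ≤ p) (L : NNReal) :
    LipschitzOnWith L (fun x : EuclideanSpace ℝ (Fin n) => lorSum r p x.ofLp)
      {x | p * √(gradSq r p x.ofLp) ≤ L} := by
  refine LipschitzOnWith.of_dist_le_mul fun x hx y hy => ?_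
  rw [Real.dist_eq, dist_eq_norm, abs_le]
  have h1 := lorSum_sub_le hr hp x y
  have h2 := lorSum_sub_le hr hp y x
  rw [norm_sub_rev] at h2
  have h3 := mul_le_mul_of_nonneg_right (show p * √(gradSq r p x.ofLp) ≤ L from hx)
    (norm_nonneg (x - y))
  have h4 := mul_le_mul_of_nonneg_right (show p * √(gradSq r p y.ofLp) ≤ L from hy)
    (norm_nonneg (x - y))
  constructor <;> linarith

lemma sum_decRe_sq_le {n : ℕ} {C q : ℝ} {y : Fin n → ℝ} (hy : SqBounded C q y) {m : ℕ}
    (hm : 1 ≤ m) (hmn : m ≤ n) :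
    ∑ i with (i : Fin n).val < m, decRe y i ^ 2 ≤ C * (topEntropy n m + q) := by
  have hcard : (Finset.univ.filter fun i : Fin n => i.val < m).card = m := by
    rw [Fin.card_filter_val_lt]; exact min_eq_right hmn
  have := hy ((Finset.univ.filter fun i : Fin n => i.val < m).map (decPerm y).toEmbedding) (by
    rw [Finset.map_nonempty, ← Finset.card_pos, hcard]; exact hm)
  rw [Finset.card_map, hcard, Finset.sum_map] at this
  simpa [decRe_eq, sq_abs] using this

lemma decRe_sq_le {n : ℕ} {C q : ℝ} {y : Fin n → ℝ} (hy : SqBounded C q y) (i : Fin n) :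
    decRe y i ^ 2 ≤ C * (1 + Real.log (n / (i + 1)) + q / (i + 1)) := by
  have h := sum_decRe_sq_le hy (m := i + 1) (by omega) i.2
  have hcard : (Finset.univ.filter fun j : Fin n => j.val < i + 1).card = i + 1 := by
    rw [Fin.card_filter_val_lt]; exact min_eq_right i.2
  have h2 : ((i : ℕ) + 1 : ℝ) * decRe y i ^ 2 ≤
      ∑ j with (j : Fin n).val < i + 1, decRe y j ^ 2 := by
    have : ∑ j with (j : Fin n).val < i + 1, decRe y i ^ 2 = ((i : ℕ) + 1 : ℝ) * decRe y i ^ 2 := by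
      rw [Finset.sum_const, hcard, nsmul_eq_mul]; push_cast; rfl
    rw [← this]
    refine Finset.sum_le_sum fun j hj => ?_
    refine pow_le_pow_left₀ (decRe_nonneg _ _) (decRe_antitone y ?_) 2
    have := (Finset.mem_filter.1 hj).2
    exact Fin.le_def.2 (by omega)
  have h3 := h2.trans h
  have hi : (0 : ℝ) < (i : ℕ) + 1 := by positivity
  rw [← le_div_iff₀' hi] at h3
  refine h3.trans (le_of_eq ?_)
  unfold topEntropy
  push_cast
  field_simp

lemma le_decRe_of_card {n : ℕ} {δ : ℝ} {y : Fin n → ℝ} {i : Fin n}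
    (h : (i : ℕ) < (Finset.univ.filter fun j => δ ≤ |y j|).card) : δ ≤ decRe y i := by
  by_contra! hlt
  have hsub : (Finset.univ.filter fun j => δ ≤ |y j|) ⊆
      (Finset.univ.filter fun j : Fin n => j.val < i).map (decPerm y).toEmbedding := by
    intro j hj
    rw [Finset.mem_map]
    refine ⟨(decPerm y).symm j, ?_, by simp⟩
    simp only [Finset.mem_filter, Finset.mem_univ, true_and] at hj ⊢
    by_contra! hle
    have := decRe_antitone y (Fin.le_def.2 hle)
    rw [decRe_eq y ((decPerm y).symm j), Equiv.apply_symm_apply] at this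
    linarith
  have := Finset.card_le_card hsub
  rw [Finset.card_map, Fin.card_filter_val_lt] at this
  omega

lemma one_add_log_ge_one {n : ℕ} (i : Fin n) : 1 ≤ 1 + Real.log (n / (i + 1)) := by
  have : 0 ≤ Real.log (n / ((i : ℝ) + 1)) := by
    refine Real.log_nonneg ?_
    rw [le_div_iff₀ (by positivity), one_mul]
    exact_mod_cast i.2
  linarith

/-- The logarithmic part of the gradient estimate. -/
noncomputable def logPart (n : ℕ) (r p : ℝ) : ℝ :=
  ∑ i : Fin n, ((i : ℝ) + 1) ^ (-(2 * r)) * (1 + Real.log (n / (i + 1))) ^ (p - 1)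

/-- The dimensional part of the gradient estimate. -/
noncomputable def dimPart (n : ℕ) (r p : ℝ) : ℝ :=
  if p = 2 - 2 * r then (∑ i : Fin n, ((i : ℝ) + 1) ^ (-1 : ℝ)) ^ (2 * r)
  else ∑ i : Fin n, ((i : ℝ) + 1) ^ (-(2 * r + p - 1))

lemma gradSq_term {n : ℕ} (r p : ℝ) (y : Fin n → ℝ) (i : Fin n) :
    (((i : ℝ) + 1) ^ (-r) * decRe y i ^ (p - 1)) ^ 2 =
      ((i : ℝ) + 1) ^ (-(2 * r)) * (decRe y i ^ 2) ^ (p - 1) := by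
  have hi : (0 : ℝ) ≤ (i : ℝ) + 1 := by positivity
  rw [mul_pow, ← Real.rpow_natCast, ← Real.rpow_mul hi, ← Real.rpow_natCast (decRe y i ^ (p - 1)),
    ← Real.rpow_natCast (decRe y i), ← Real.rpow_mul (decRe_nonneg _ _),
    ← Real.rpow_mul (decRe_nonneg _ _)]
  congr 2
  · push_cast; ring
  · push_cast; ring

lemma gradSq_le_of_ne {n : ℕ} {r p C q : ℝ} (hp : 1 ≤ p) (hC : 0 ≤ C)
    (hq : 0 ≤ q) {y : Fin n → ℝ} (hy : SqBounded C q y) :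
    gradSq r p y ≤ (2 * C) ^ (p - 1) *
      (logPart n r p + q ^ (p - 1) * ∑ i : Fin n, ((i : ℝ) + 1) ^ (-(2 * r + p - 1))) := by
  have hp1 : 0 ≤ p - 1 := by linarith
  rw [gradSq, logPart, Finset.mul_sum, ← Finset.sum_add_distrib, Finset.mul_sum]
  refine Finset.sum_le_sum fun i _ => ?_
  rw [gradSq_term]
  have hi : (0 : ℝ) < (i : ℝ) + 1 := by positivity
  have hl := one_add_log_ge_one i
  set l := 1 + Real.log (n / ((i : ℝ) + 1)) with hl'
  have h1 := decRe_sq_le hy i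
  rw [← hl'] at h1
  have hqi : 0 ≤ q / ((i : ℝ) + 1) := by positivity
  have h2 : (decRe y i ^ 2) ^ (p - 1) ≤
      (2 * C) ^ (p - 1) * (l ^ (p - 1) + (q / ((i : ℝ) + 1)) ^ (p - 1)) := by
    have hm : decRe y i ^ 2 ≤ 2 * C * max l (q / ((i : ℝ) + 1)) := by
      refine h1.trans ?_
      have := le_max_left l (q / ((i : ℝ) + 1))
      have := le_max_right l (q / ((i : ℝ) + 1))
      nlinarith
    refine (Real.rpow_le_rpow (sq_nonneg _) hm hp1).trans ?_
    rw [Real.mul_rpow (by positivity) (le_max_of_le_right hqi)]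
    refine mul_le_mul_of_nonneg_left ?_ (by positivity)
    have p1 : 0 ≤ l ^ (p - 1) := Real.rpow_nonneg (by linarith) _
    have p2 := Real.rpow_nonneg hqi (p - 1)
    rcases max_cases l (q / ((i : ℝ) + 1)) with ⟨h, -⟩ | ⟨h, -⟩ <;> rw [h] <;> linarith
  refine (mul_le_mul_of_nonneg_left h2 (by positivity)).trans (le_of_eq ?_)
  have e : ((i : ℝ) + 1) ^ (-(2 * r + p - 1)) =
      ((i : ℝ) + 1) ^ (-(2 * r)) * ((i : ℝ) + 1) ^ (-(p - 1)) := by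
    rw [← Real.rpow_add hi]; congr 1; ring
  rw [e, Real.div_rpow hq hi.le, Real.rpow_neg hi.le (p - 1)]
  ring

lemma gradSq_le_of_eq {n : ℕ} {r p C q : ℝ} (hr : 0 ≤ r) (hr2 : r ≤ 1 / 2) (hpr : p = 2 - 2 * r)
    (hC : 0 < C) (hq : 0 < q) {y : Fin n → ℝ} (hy : SqBounded C q y) :
    gradSq r p y ≤ (2 * C) ^ (p - 1) *
      (logPart n r p + q ^ (p - 1) * (∑ i : Fin n, ((i : ℝ) + 1) ^ (-1 : ℝ)) ^ (2 * r)) := by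
  classical
  have hp1 : 0 ≤ p - 1 := by linarith
  set S := ∑ i : Fin n, ((i : ℝ) + 1) ^ (-1 : ℝ) with hS
  have hS0 : 0 ≤ S := Finset.sum_nonneg fun i _ => by positivity
  set Q := 2 * C * q with hQ
  have hQ0 : 0 < Q := by positivity
  set m := Nat.findGreatest (fun m => topEntropy n m < q) n with hm
  have hmn : m ≤ n := Nat.findGreatest_le n
  have hpt : ∀ i : Fin n, (((i : ℝ) + 1) ^ (-r) * decRe y i ^ (p - 1)) ^ 2 ≤
      (2 * C) ^ (p - 1) * (((i : ℝ) + 1) ^ (-(2 * r)) *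
        (1 + Real.log (n / (i + 1))) ^ (p - 1)) +
      if (i : ℕ) < m then ((i : ℝ) + 1) ^ (-(2 * r)) * (decRe y i ^ 2) ^ (p - 1) else 0 := by
    intro i
    rw [gradSq_term]
    have hi : (0 : ℝ) < (i : ℝ) + 1 := by positivity
    have hl := one_add_log_ge_one i
    split_ifs with him
    · have : 0 ≤ (2 * C) ^ (p - 1) * (((i : ℝ) + 1) ^ (-(2 * r)) *
        (1 + Real.log (n / (i + 1))) ^ (p - 1)) := by
          have : 0 ≤ (1 + Real.log (n / ((i : ℝ) + 1))) ^ (p - 1) :=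
            Real.rpow_nonneg (by linarith) _
          positivity
      linarith
    · have hge : q ≤ topEntropy n (i + 1) := by
        have := Nat.findGreatest_is_greatest (P := fun m => topEntropy n m < q) (n := n)
          (k := i + 1) (by omega) i.2
        simpa using this
      have h1 := decRe_sq_le hy i
      unfold topEntropy at hge
      push_cast at hge
      rw [← div_le_iff₀' hi] at hge
      have h2 : decRe y i ^ 2 ≤ 2 * C * (1 + Real.log (n / (i + 1))) := by nlinarith
      have h3 := Real.rpow_le_rpow (sq_nonneg _) h2 hp1
      rw [Real.mul_rpow (by positivity) (by linarith)] at h3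
      rw [add_zero]
      refine (mul_le_mul_of_nonneg_left h3 (by positivity)).trans (le_of_eq ?_)
      ring
  have hhead : ∑ i with (i : Fin n).val < m,
      ((i : ℝ) + 1) ^ (-(2 * r)) * (decRe y i ^ 2) ^ (p - 1) ≤ S ^ (2 * r) * Q ^ (p - 1) := by
    rcases Nat.eq_zero_or_pos m with h0 | h0
    · rw [h0]
      simp only [not_lt_zero, Finset.filter_false, Finset.sum_empty]
      positivity
    have hspec : topEntropy n m < q := Nat.findGreatest_of_ne_zero hm.symm h0.ne'
    have hsum := sum_decRe_sq_le hy h0 hmn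
    have hsumQ : ∑ i with (i : Fin n).val < m, decRe y i ^ 2 ≤ Q := by
      refine hsum.trans ?_
      rw [hQ]; nlinarith
    have hSpos : 0 < S := by
      have hn : 0 < n := h0.trans_le hmn
      exact Finset.sum_pos (fun i _ => by positivity) ⟨⟨0, hn⟩, Finset.mem_univ _⟩
    have hterm : ∀ i : Fin n, ((i : ℝ) + 1) ^ (-(2 * r)) * (decRe y i ^ 2) ^ (p - 1) ≤
        S ^ (2 * r) * Q ^ (p - 1) *
          (2 * r * (((i : ℝ) + 1) ^ (-1 : ℝ) / S) + (p - 1) * (decRe y i ^ 2 / Q)) := by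
      intro i
      have hi : (0 : ℝ) < (i : ℝ) + 1 := by positivity
      have h := Real.geom_mean_le_arith_mean2_weighted (w₁ := 2 * r) (w₂ := p - 1)
        (p₁ := ((i : ℝ) + 1) ^ (-1 : ℝ) / S) (p₂ := decRe y i ^ 2 / Q) (by linarith) hp1
        (by positivity) (by positivity) (by linarith)
      refine le_trans (le_of_eq ?_) (mul_le_mul_of_nonneg_left h (by positivity))
      rw [Real.div_rpow (by positivity) hS0, Real.div_rpow (by positivity) hQ0.le,
        ← Real.rpow_mul hi.le]
      have : 0 < S ^ (2 * r) := by positivity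
      have : 0 < Q ^ (p - 1) := by positivity
      field_simp
    refine (Finset.sum_le_sum fun i _ => hterm i).trans ?_
    rw [← Finset.mul_sum, Finset.sum_add_distrib, ← Finset.mul_sum, ← Finset.mul_sum,
      ← Finset.sum_div, ← Finset.sum_div]
    refine mul_le_of_le_one_right (by positivity) ?_
    have h1 : (∑ i with (i : Fin n).val < m, ((i : ℝ) + 1) ^ (-1 : ℝ)) / S ≤ 1 := by
      rw [div_le_one hSpos]
      exact Finset.sum_le_sum_of_subset_of_nonneg (Finset.filter_subset _ _)
        fun i _ _ => by positivity
    have h2 : (∑ i with (i : Fin n).val < m, decRe y i ^ 2) / Q ≤ 1 := by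
      rwa [div_le_one hQ0]
    nlinarith
  rw [gradSq]
  refine (Finset.sum_le_sum fun i _ => hpt i).trans ?_
  rw [Finset.sum_add_distrib, ← Finset.mul_sum, ← Finset.sum_filter, mul_add, logPart]
  refine add_le_add le_rfl (hhead.trans (le_of_eq ?_))
  rw [hQ, Real.mul_rpow (by positivity) hq.le]
  ring

/-- The gradient estimate. -/
lemma gradSq_le {n : ℕ} {r p C q : ℝ} (hr : 0 ≤ r) (hp : 1 ≤ p) (hC : 0 < C)
    (hq : 0 < q) {y : Fin n → ℝ} (hy : SqBounded C q y) :
    gradSq r p y ≤ (2 * C) ^ (p - 1) * (logPart n r p + q ^ (p - 1) * dimPart n r p) := by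
  unfold dimPart
  split_ifs with h
  · exact gradSq_le_of_eq hr (by linarith) h hC hq hy
  · exact gradSq_le_of_ne hp hC.le hq.le hy

lemma sum_rpow_le_of_lt_one {a : ℝ} (ha0 : 0 ≤ a) (ha : a < 1) (n : ℕ) :
    ∑ i : Fin n, ((i : ℝ) + 1) ^ (-a) ≤ (n : ℝ) ^ (1 - a) / (1 - a) := by
  have h1a : 0 < 1 - a := by linarith
  rw [Fin.sum_univ_eq_sum_range (fun i : ℕ => ((i : ℝ) + 1) ^ (-a))]
  induction n with
  | zero => simp [Real.zero_rpow h1a.ne']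
  | succ n ih =>
    rw [Finset.sum_range_succ]
    have hn : (0 : ℝ) < n + 1 := by positivity
    have hb := rpow_one_add_le_one_add_mul_self (s := (n : ℝ) / (n + 1) - 1) (by
      have : (0 : ℝ) ≤ n / (n + 1) := by positivity
      linarith) h1a.le (by linarith)
    rw [add_sub_cancel, Real.div_rpow (by positivity) hn.le, div_le_iff₀ (by positivity)] at hb
    have e : ((n : ℝ) + 1) ^ (1 - a) = ((n : ℝ) + 1) ^ (-a) * (n + 1) := by
      rw [← Real.rpow_add_one hn.ne']; congr 1; ring
    have e2 : (1 + (1 - a) * ((n : ℝ) / (n + 1) - 1)) * ((n : ℝ) + 1) ^ (1 - a) =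
        ((n : ℝ) + 1) ^ (1 - a) - (1 - a) * ((n : ℝ) + 1) ^ (-a) := by
      rw [e]; field_simp; ring
    rw [e2] at hb
    refine (add_le_add ih le_rfl).trans ?_
    rw [div_add' _ _ _ h1a.ne']
    push_cast
    gcongr
    linarith

lemma sum_rpow_neg_one_le (n : ℕ) :
    ∑ i : Fin n, ((i : ℝ) + 1) ^ (-1 : ℝ) ≤ 1 + Real.log n := by
  have := harmonic_le_one_add_log n
  rw [Fin.sum_univ_eq_sum_range (fun i : ℕ => ((i : ℝ) + 1) ^ (-1 : ℝ))]
  refine le_trans (le_of_eq ?_) this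
  simp [harmonic, Real.rpow_neg_one]

lemma exists_sum_rpow_le {a : ℝ} (ha : 1 < a) :
    ∃ K : ℝ, 0 < K ∧ ∀ n : ℕ, ∑ i : Fin n, ((i : ℝ) + 1) ^ (-a) ≤ K := by
  have h1 : Summable fun i : ℕ => ((i : ℝ) + 1) ^ (-a) := by
    have := (summable_nat_add_iff 1).2 (Real.summable_nat_rpow.2 (by linarith : -a < -1))
    simpa using this
  refine ⟨(∑' i : ℕ, ((i : ℝ) + 1) ^ (-a)) + 1, ?_, fun n => ?_⟩
  · have : 0 ≤ ∑' i : ℕ, ((i : ℝ) + 1) ^ (-a) := tsum_nonneg fun i => by positivity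
    linarith
  · rw [Fin.sum_univ_eq_sum_range (fun i : ℕ => ((i : ℝ) + 1) ^ (-a))]
    have := h1.sum_le_tsum (Finset.range n) (fun i _ => by positivity)
    linarith

lemma exists_logPart_le_of_lt {r p : ℝ} (hr : 0 ≤ r) (hr2 : r < 1 / 2) (hp : 1 ≤ p) :
    ∃ K : ℝ, 0 < K ∧ ∀ n : ℕ, logPart n r p ≤ K * (n : ℝ) ^ (1 - 2 * r) := by
  set s := (1 - 2 * r) / 2 with hs
  have hs0 : 0 < s := by rw [hs]; linarith
  have hp0 : 0 < p := by linarith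
  refine ⟨(p / s) ^ (p - 1) * Real.exp s / s, by positivity, fun n => ?_⟩
  have hterm : ∀ i : Fin n, ((i : ℝ) + 1) ^ (-(2 * r)) * (1 + Real.log (n / (i + 1))) ^ (p - 1) ≤
      (p / s) ^ (p - 1) * Real.exp s * (n : ℝ) ^ s * ((i : ℝ) + 1) ^ (-(2 * r + s)) := by
    intro i
    have hi : (0 : ℝ) < (i : ℝ) + 1 := by positivity
    have hn : (0 : ℝ) < n := by exact_mod_cast i.pos
    have hl := one_add_log_ge_one i
    set z : ℝ := Real.exp 1 * (n / ((i : ℝ) + 1)) with hz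
    have hz0 : 0 < z := by positivity
    have hlz : 1 + Real.log (n / (i + 1)) = Real.log z := by
      rw [hz, Real.log_mul (Real.exp_pos _).ne' (by positivity), Real.log_exp]
    rw [hlz] at hl ⊢
    have hz1 : 1 ≤ z := by
      by_contra! h
      have := Real.log_neg hz0 h
      linarith
    have h1 : Real.log z ≤ z ^ (s / p) / (s / p) := Real.log_le_rpow_div hz0.le (by positivity)
    have h2 : Real.log z ^ (p - 1) ≤ (p / s) ^ (p - 1) * z ^ s := by
      refine (Real.rpow_le_rpow (by linarith) h1 (by linarith)).trans ?_
      have : z ^ (s / p) / (s / p) = p / s * z ^ (s / p) := by field_simp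
      rw [this, Real.mul_rpow (by positivity) (by positivity), ← Real.rpow_mul hz0.le]
      refine mul_le_mul_of_nonneg_left (Real.rpow_le_rpow_of_exponent_le hz1 ?_) (by positivity)
      rw [div_mul_eq_mul_div, div_le_iff₀ hp0]
      nlinarith
    refine (mul_le_mul_of_nonneg_left h2 (by positivity)).trans (le_of_eq ?_)
    have e : ((i : ℝ) + 1) ^ (-(2 * r + s)) =
        ((i : ℝ) + 1) ^ (-(2 * r)) * (((i : ℝ) + 1) ^ s)⁻¹ := by
      rw [← Real.rpow_neg hi.le, ← Real.rpow_add hi]; congr 1; ring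
    rw [e, hz, Real.mul_rpow (Real.exp_pos _).le (by positivity), Real.div_rpow hn.le hi.le,
      ← Real.exp_mul, one_mul]
    ring
  rw [logPart]
  refine (Finset.sum_le_sum fun i _ => hterm i).trans ?_
  rw [← Finset.mul_sum]
  refine (mul_le_mul_of_nonneg_left (sum_rpow_le_of_lt_one (a := 2 * r + s) (by linarith)
    (by linarith) n) (by positivity)).trans (le_of_eq ?_)
  have e3 : 1 - (2 * r + s) = s := by linarith
  have e4 : (n : ℝ) ^ (1 - 2 * r) = (n : ℝ) ^ s * (n : ℝ) ^ s := by
    rw [← Real.rpow_add_of_nonneg (by positivity) hs0.le hs0.le]; congr 1; rw [hs]; ring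
  rw [e3, e4]
  ring

lemma logPart_le {n : ℕ} (r : ℝ) {p : ℝ} (hp : 1 ≤ p) :
    logPart n r p ≤ (1 + Real.log n) ^ (p - 1) * ∑ i : Fin n, ((i : ℝ) + 1) ^ (-(2 * r)) := by
  rw [logPart, Finset.mul_sum]
  refine Finset.sum_le_sum fun i _ => ?_
  have hi : (1 : ℝ) ≤ (i : ℝ) + 1 := by linarith [(Nat.cast_nonneg (i : ℕ) : (0 : ℝ) ≤ (i : ℕ))]
  have hn : (0 : ℝ) < n := by exact_mod_cast i.pos
  rw [mul_comm]
  refine mul_le_mul_of_nonneg_right (Real.rpow_le_rpow (by linarith [one_add_log_ge_one i]) ?_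
    (by linarith)) (by positivity)
  have : Real.log (n / ((i : ℝ) + 1)) ≤ Real.log n :=
    Real.log_le_log (by positivity) (div_le_self hn.le hi)
  linarith

lemma one_add_log_le {n : ℕ} (hn : 2 ≤ n) : 1 + Real.log n ≤ 3 * Real.log n := by
  have : Real.log 2 ≤ Real.log n := Real.log_le_log (by norm_num) (by exact_mod_cast hn)
  linarith [Real.log_two_gt_d9]

/-- The square of the order of magnitude of the `p`-th power of the median of `lorNorm r p`. -/
noncomputable def medianSq (n : ℕ) (r p : ℝ) : ℝ :=
  if r < 1 then (n : ℝ) ^ (2 * (1 - r)) else Real.log n ^ (p + 2)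

lemma rpow_le_of_le_rpow_div {D x ε a p : ℝ} (hD : 0 ≤ D) (hx : 0 ≤ x) (hε : 0 ≤ ε) (hp : 1 ≤ p)
    (h : D ≤ x ^ (a / p) * ε ^ (2 / p)) : D ^ p ≤ x ^ a * ε ^ 2 := by
  have hp0 : p ≠ 0 := by linarith
  refine (Real.rpow_le_rpow hD h (by linarith)).trans (le_of_eq ?_)
  rw [Real.mul_rpow (by positivity) (by positivity), ← Real.rpow_mul hx, ← Real.rpow_mul hε,
    div_mul_cancel₀ _ hp0, div_mul_cancel₀ _ hp0]
  norm_cast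

lemma logPart_nonneg (n : ℕ) (r p : ℝ) : 0 ≤ logPart n r p :=
  Finset.sum_nonneg fun i _ => mul_nonneg (by positivity)
    (Real.rpow_nonneg (by linarith [one_add_log_ge_one i]) _)

lemma dimPart_nonneg (n : ℕ) (r p : ℝ) : 0 ≤ dimPart n r p := by
  unfold dimPart
  split_ifs
  · exact Real.rpow_nonneg (Finset.sum_nonneg fun i _ => by positivity) _
  · exact Finset.sum_nonneg fun i _ => by positivity

lemma exists_dimPart_le {r p : ℝ} (h : 2 - 2 * r < p) : ∃ K > 0, ∀ n : ℕ, dimPart n r p ≤ K := by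
  obtain ⟨K, hK, h1⟩ := exists_sum_rpow_le (a := 2 * r + p - 1) (by linarith)
  refine ⟨K, hK, fun n => ?_⟩
  rw [dimPart, if_neg h.ne']
  exact h1 n

lemma log_pos_of_two_le {n : ℕ} (hn : 2 ≤ n) : 0 < Real.log n :=
  Real.log_pos (by exact_mod_cast hn)

lemma dimAsy_pos {n : ℕ} {r p ε : ℝ} (hn : 2 ≤ n) (hε : 0 < ε) : 0 < dimAsy n r p ε := by
  have hl := log_pos_of_two_le hn
  have hn0 : (0 : ℝ) < n := by exact_mod_cast (by omega : 0 < n)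
  unfold dimAsy
  split_ifs <;> positivity

lemma exists_dimAsy_mul_logPart_le {r p : ℝ} (hr : 0 ≤ r) (hr1 : r ≤ 1) (hp : 1 ≤ p) :
    ∃ K > 0, ∀ (n : ℕ) (ε : ℝ), 2 ≤ n → 0 < ε → ε < 1 →
      dimAsy n r p ε * logPart n r p ≤ K * (medianSq n r p * ε ^ 2) := by
  rcases lt_trichotomy r (1 / 2) with h | h | h
  · obtain ⟨K, hK, hl⟩ := exists_logPart_le_of_lt hr h hp
    refine ⟨K, hK, fun n ε hn h0 h1 => ?_⟩
    have hn0 : (0 : ℝ) < n := by exact_mod_cast (by omega : 0 < n)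
    have hD : dimAsy n r p ε ≤ n * ε ^ 2 := by
      unfold dimAsy
      rw [if_pos h]
      split_ifs
      · exact le_rfl
      · exact min_le_left _ _
      · exact min_le_left _ _
    rw [medianSq, if_pos (by linarith)]
    refine (mul_le_mul hD (hl n) (logPart_nonneg _ _ _) (by positivity)).trans (le_of_eq ?_)
    have e : (n : ℝ) ^ (2 * (1 - r)) = n * (n : ℝ) ^ (1 - 2 * r) := by
      rw [← Real.rpow_one_add' hn0.le (by linarith)]; congr 1; ring
    rw [e]; ring
  · refine ⟨3 ^ p, by positivity, fun n ε hn h0 h1 => ?_⟩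
    have hn0 : (0 : ℝ) < n := by exact_mod_cast (by omega : 0 < n)
    have hl0 := log_pos_of_two_le hn
    have hD : dimAsy n r p ε ≤ n * Real.log n ^ (-p) * ε ^ 2 := by
      unfold dimAsy
      rw [if_neg (by linarith), if_pos h]
      split_ifs with h1
      · rw [h1]
      · exact min_le_left _ _
    have hL : logPart n r p ≤ (3 * Real.log n) ^ p := by
      refine (logPart_le r hp).trans ?_
      have h3 := one_add_log_le hn
      have hs := sum_rpow_neg_one_le n
      have e : (3 * Real.log n) ^ p = (3 * Real.log n) ^ (p - 1) * (3 * Real.log n) := by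
        rw [← Real.rpow_add_one (by positivity)]; congr 1; ring
      rw [e, h]
      refine mul_le_mul (Real.rpow_le_rpow (by linarith) h3 (by linarith)) ?_
        (Finset.sum_nonneg fun i _ => by positivity) (by positivity)
      norm_num at hs ⊢
      linarith
    rw [medianSq, if_pos (by linarith)]
    refine (mul_le_mul hD hL (logPart_nonneg _ _ _) (by positivity)).trans (le_of_eq ?_)
    rw [Real.mul_rpow (by norm_num) hl0.le, Real.rpow_neg hl0.le, h]
    have : Real.log n ^ p ≠ 0 := by positivity
    norm_num
    field_simp
  · obtain ⟨K, hK, hl⟩ := exists_sum_rpow_le (a := 2 * r) (by linarith)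
    have hL : ∀ n : ℕ, 2 ≤ n → logPart n r p ≤ 3 ^ (p - 1) * Real.log n ^ (p - 1) * K := by
      intro n hn
      have hl0 := log_pos_of_two_le hn
      refine (logPart_le r hp).trans ?_
      have h3 := one_add_log_le hn
      rw [← Real.mul_rpow (by norm_num) hl0.le]
      exact mul_le_mul (Real.rpow_le_rpow (by linarith) h3 (by linarith)) (hl n)
        (Finset.sum_nonneg fun i _ => by positivity) (by positivity)
    refine ⟨3 ^ (p - 1) * K, by positivity, fun n ε hn h0 h1 => ?_⟩
    have hn0 : (0 : ℝ) < n := by exact_mod_cast (by omega : 0 < n)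
    have hl0 := log_pos_of_two_le hn
    have hq : Real.log n ^ (p - 1) ≠ 0 := by positivity
    rcases hr1.lt_or_eq with h2 | h2
    · have hD : dimAsy n r p ε ≤ (n : ℝ) ^ (2 * (1 - r)) * Real.log n ^ (-(p - 1)) * ε ^ 2 := by
        unfold dimAsy
        rw [if_neg (by linarith), if_neg (by linarith), if_pos h2]
        exact min_le_left _ _
      rw [medianSq, if_pos h2]
      refine (mul_le_mul hD (hL n hn) (logPart_nonneg _ _ _) (by positivity)).trans (le_of_eq ?_)
      rw [Real.rpow_neg hl0.le]
      field_simp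
    · have hD : dimAsy n r p ε ≤ Real.log n ^ (3 : ℝ) * ε ^ 2 := by
        unfold dimAsy
        rw [if_neg (by linarith), if_neg (by linarith), if_neg (by linarith)]
        exact min_le_left _ _
      rw [medianSq, if_neg (by linarith)]
      refine (mul_le_mul hD (hL n hn) (logPart_nonneg _ _ _) (by positivity)).trans (le_of_eq ?_)
      have e : Real.log n ^ (p + 2) = Real.log n ^ (3 : ℝ) * Real.log n ^ (p - 1) := by
        rw [← Real.rpow_add hl0]; congr 1; ring
      rw [e]; ring

lemma exists_dimAsy_rpow_mul_dimPart_le {r p : ℝ} (hr : 0 ≤ r) (hr1 : r ≤ 1) (hp : 1 ≤ p) :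
    ∃ K > 0, ∀ (n : ℕ) (ε : ℝ), 2 ≤ n → 0 < ε → ε < 1 →
      dimAsy n r p ε ^ p * dimPart n r p ≤ K * (medianSq n r p * ε ^ 2) := by
  rcases lt_trichotomy p (2 - 2 * r) with h | h | h
  · refine ⟨1 / (1 - (2 * r + p - 1)), by apply one_div_pos.2; linarith, fun n ε hn h0 h1 => ?_⟩
    have hn0 : (0 : ℝ) < n := by exact_mod_cast (by omega : 0 < n)
    have hD : dimAsy n r p ε = n * ε ^ 2 := by
      unfold dimAsy
      rw [if_pos (by linarith), if_pos h]
    have hs := sum_rpow_le_of_lt_one (a := 2 * r + p - 1) (by linarith) (by linarith) n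
    rw [hD, dimPart, if_neg h.ne, medianSq, if_pos (by linarith),
      Real.mul_rpow hn0.le (by positivity)]
    have hε : (ε ^ 2) ^ p ≤ ε ^ 2 := by
      have := Real.rpow_le_rpow_of_exponent_ge (x := ε ^ 2) (by positivity) (by nlinarith) hp
      rwa [Real.rpow_one] at this
    have e : (n : ℝ) ^ (2 * (1 - r)) = (n : ℝ) ^ p * (n : ℝ) ^ (1 - (2 * r + p - 1)) := by
      rw [← Real.rpow_add hn0]; congr 1; ring
    refine (mul_le_mul (mul_le_mul_of_nonneg_left hε (by positivity)) hs
      (Finset.sum_nonneg fun i _ => by positivity) (by positivity)).trans (le_of_eq ?_)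
    rw [e]; ring
  · refine ⟨3 ^ (2 * r), by positivity, fun n ε hn h0 h1 => ?_⟩
    have hn0 : (0 : ℝ) < n := by exact_mod_cast (by omega : 0 < n)
    have hl0 := log_pos_of_two_le hn
    have hD0 := (dimAsy_pos (r := r) (p := p) hn h0).le
    have hD : dimAsy n r p ε ^ p ≤ (n : ℝ) ^ p * Real.log n ^ (-(2 * r)) * ε ^ 2 := by
      rcases (show r ≤ 1 / 2 by linarith).lt_or_eq with h2 | h2
      · have h3 : dimAsy n r p ε ≤ (n * Real.log n ^ (1 - 2 / p)) * ε ^ (2 / p) := by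
          unfold dimAsy
          rw [if_pos h2, if_neg h.not_lt, if_pos h]
          exact min_le_right _ _
        have h4 := rpow_le_of_le_rpow_div (x := n * Real.log n ^ (1 - 2 / p)) (a := p) hD0
          (by positivity) h0.le hp (by rw [div_self (by linarith), Real.rpow_one]; exact h3)
        rw [Real.mul_rpow hn0.le (by positivity), ← Real.rpow_mul hl0.le] at h4
        have e : (1 - 2 / p) * p = -(2 * r) := by
          have : p ≠ 0 := by linarith
          field_simp
          linarith
        rwa [e] at h4
      · have hp1 : p = 1 := by linarith
        unfold dimAsy
        rw [if_neg (by linarith), if_pos h2, if_pos hp1, hp1, h2]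
        norm_num
    have hs : dimPart n r p ≤ (3 * Real.log n) ^ (2 * r) := by
      rw [dimPart, if_pos h]
      exact Real.rpow_le_rpow (Finset.sum_nonneg fun i _ => by positivity)
        ((sum_rpow_neg_one_le n).trans (one_add_log_le hn)) (by linarith)
    rw [medianSq, if_pos (by linarith)]
    refine (mul_le_mul hD hs (dimPart_nonneg _ _ _) (by positivity)).trans (le_of_eq ?_)
    have hq : Real.log n ^ (2 * r) ≠ 0 := by positivity
    have e : 2 * (1 - r) = p := by linarith
    rw [Real.mul_rpow (by norm_num) hl0.le, Real.rpow_neg hl0.le, e]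
    field_simp
  · obtain ⟨K, hK, hd⟩ := exists_dimPart_le h
    refine ⟨K, hK, fun n ε hn h0 h1 => ?_⟩
    have hn0 : (0 : ℝ) < n := by exact_mod_cast (by omega : 0 < n)
    have hl0 := log_pos_of_two_le hn
    have hD0 := (dimAsy_pos (r := r) (p := p) hn h0).le
    have hD : dimAsy n r p ε ^ p ≤ medianSq n r p * ε ^ 2 := by
      rcases hr1.lt_or_eq with h2 | h2
      · rw [medianSq, if_pos h2]
        refine rpow_le_of_le_rpow_div hD0 hn0.le h0.le hp ?_
        unfold dimAsy
        split_ifs with h3 h4 h5 h6 h7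
        · linarith
        · linarith
        · exact min_le_right _ _
        · exfalso; linarith
        · refine (min_le_right _ _).trans (le_of_eq ?_)
          rw [h6]; norm_num
        · exact min_le_right _ _
      · rw [medianSq, if_neg (by linarith)]
        refine rpow_le_of_le_rpow_div hD0 hl0.le h0.le hp ?_
        unfold dimAsy
        rw [if_neg (by linarith), if_neg (by linarith), if_neg (by linarith)]
        refine (min_le_right _ _).trans (le_of_eq ?_)
        rw [add_div, div_self (by linarith : p ≠ 0)]
    calc _ ≤ (medianSq n r p * ε ^ 2) * K :=
          mul_le_mul hD (hd n) (dimPart_nonneg _ _ _) (le_trans (by positivity) hD)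
      _ = _ := by ring

/-- The number of coordinates of absolute value at least `δ`. -/
noncomputable def largeCount {n : ℕ} (δ : ℝ) (y : Fin n → ℝ) : ℕ :=
  (Finset.univ.filter fun j => δ ≤ |y j|).card

lemma largeCount_le {n : ℕ} (δ : ℝ) (y : Fin n → ℝ) : largeCount δ y ≤ n :=
  (Finset.card_le_univ _).trans (Fintype.card_fin n).le

lemma le_lorSum {n : ℕ} {r p δ : ℝ} (hp : 0 ≤ p) (hδ : 0 ≤ δ) (y : Fin n → ℝ) :
    δ ^ p * ∑ i ∈ Finset.range (largeCount δ y), ((i : ℝ) + 1) ^ (-r) ≤ lorSum r p y := by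
  rw [lorSum, Finset.sum_fin_eq_sum_range, Finset.mul_sum]
  refine (Finset.sum_le_sum fun i hi => ?_).trans (Finset.sum_le_sum_of_subset_of_nonneg
    (Finset.range_subset_range.2 (largeCount_le δ y)) fun i _ _ => ?_)
  · have hin : i < n := (Finset.mem_range.1 hi).trans_le (largeCount_le δ y)
    rw [dif_pos hin, mul_comm]
    refine mul_le_mul_of_nonneg_left (Real.rpow_le_rpow hδ ?_ hp) (by positivity)
    exact le_decRe_of_card (Finset.mem_range.1 hi)
  · split_ifs
    · exact mul_nonneg (by positivity) (Real.rpow_nonneg (decRe_nonneg _ _) _)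
    · exact le_rfl

lemma measure_largeCount_le (n : ℕ) (δ s : ℝ) :
    _root_.stdGaussian n {y | (largeCount δ y : ℝ) ≤ s} ≤
      ENNReal.ofReal (Real.exp (s - n * (gaussianReal 0 1).real {x | δ ≤ |x|} / 2)) := by
  set A : Set ℝ := {x | δ ≤ |x|} with hA
  have hAm : MeasurableSet A := measurableSet_le measurable_const measurable_norm
  set P := (gaussianReal 0 1).real A with hP
  set h : ℝ → ℝ := fun x => A.indicator (fun _ => -1) x with hh
  have hexp : (fun x => Real.exp (h x)) =
      fun x => 1 - A.indicator (fun _ => 1 - Real.exp (-1)) x := by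
    funext x
    by_cases hx : x ∈ A <;> simp [hh, hx]
  have hi2 : Integrable (A.indicator fun _ => 1 - Real.exp (-1)) (gaussianReal 0 1) :=
    (integrable_const _).indicator hAm
  have hi : Integrable (fun x => Real.exp (h x)) (gaussianReal 0 1) := by
    rw [hexp]
    exact (integrable_const _).sub hi2
  have hb : ∫ x, Real.exp (h x) ∂(gaussianReal 0 1) ≤ Real.exp (-(P / 2)) := by
    rw [hexp, integral_sub (integrable_const _) hi2, integral_indicator_const _ hAm]
    have h1 : Real.exp (-1) ≤ 1 / 2 := by
      have := Real.exp_one_gt_d9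
      rw [Real.exp_neg, ← one_div]
      exact one_div_le_one_div_of_le (by norm_num) (by linarith)
    have h2 := Real.add_one_le_exp (-(P / 2))
    have h3 : 0 ≤ P := measureReal_nonneg
    simp only [integral_const, probReal_univ, smul_eq_mul]
    rw [← hP]
    nlinarith
  have key := measure_stdGaussian_sum_ge (n := n) (s := -s) hi hb
  refine (measure_mono ?_).trans (key.trans (le_of_eq ?_))
  · intro y hy
    have : ∑ i, h (y i) = -(largeCount δ y : ℝ) := by
      simp only [hh, largeCount, Set.indicator_apply, hA, Set.mem_ofPred_eq]
      rw [← Finset.sum_filter]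
      simp
    simp only [Set.mem_ofPred_eq] at hy ⊢
    rw [this]; linarith
  · congr 1
    rw [← Real.exp_nat_mul, ← Real.exp_add]
    congr 1; ring

lemma measureReal_gaussian_tail_ge_small :
    4 / 5 ≤ (gaussianReal 0 1).real {x | (1 : ℝ) / 5 ≤ |x|} := by
  have hm : MeasurableSet {x : ℝ | (1 : ℝ) / 5 ≤ |x|} :=
    measurableSet_le measurable_const measurable_norm
  have hc := probReal_compl_eq_one_sub (μ := gaussianReal 0 1) hm
  have hle : (gaussianReal 0 1).real {x : ℝ | (1 : ℝ) / 5 ≤ |x|}ᶜ ≤ 1 / 5 := by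
    have hsub : {x : ℝ | (1 : ℝ) / 5 ≤ |x|}ᶜ ⊆ Set.Ioo (-(1 / 5)) (1 / 5) := by
      intro x hx
      simp only [Set.mem_compl_iff, Set.mem_ofPred_eq, not_le] at hx
      exact abs_lt.1 hx
    refine (measureReal_mono hsub).trans ?_
    rw [measureReal_def, gaussianReal_apply_eq_integral _ (by norm_num)]
    rw [ENNReal.toReal_ofReal (integral_nonneg fun x => gaussianPDFReal_nonneg _ _ _)]
    have hpdf : ∀ x, gaussianPDFReal 0 1 x ≤ 1 / 2 := by
      intro x
      rw [gaussianPDFReal]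
      have h1 : Real.exp (-(x - 0) ^ 2 / (2 * ((1 : NNReal) : ℝ))) ≤ 1 := by
        rw [Real.exp_le_one_iff]
        have := sq_nonneg (x - 0)
        simp only [NNReal.coe_one]; linarith
      have h2 : (√(2 * Real.pi * ((1 : NNReal) : ℝ)))⁻¹ ≤ 1 / 2 := by
        rw [one_div]
        refine inv_anti₀ (by norm_num) (Real.le_sqrt_of_sq_le ?_)
        have := Real.pi_gt_three
        simp only [NNReal.coe_one]; linarith
      have := mul_le_mul h2 h1 (Real.exp_pos _).le (by norm_num)
      linarith
    have := setIntegral_mono (μ := volume) (s := Set.Ioo (-(1 / 5) : ℝ) (1 / 5))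
      (integrable_gaussianPDFReal 0 1).integrableOn
      (integrableOn_const (C := (1 / 2 : ℝ)) (by simp)) hpdf
    refine this.trans ?_
    simp
    norm_num
  linarith

lemma measureReal_gaussian_tail_ge (t : ℝ) :
    Real.exp (-t ^ 2 - 1) / 3 ≤ (gaussianReal 0 1).real {x | t ≤ |x|} := by
  have hsub : Set.Ioo t (t + 1) ⊆ {x : ℝ | t ≤ |x|} := by
    intro x hx
    exact hx.1.le.trans (le_abs_self x)
  refine le_trans ?_ (measureReal_mono hsub)
  rw [measureReal_def, gaussianReal_apply_eq_integral _ (by norm_num)]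
  rw [ENNReal.toReal_ofReal (integral_nonneg fun x => gaussianPDFReal_nonneg _ _ _)]
  have hpdf : ∀ x ∈ Set.Ioo t (t + 1), Real.exp (-t ^ 2 - 1) / 3 ≤ gaussianPDFReal 0 1 x := by
    intro x hx
    rw [gaussianPDFReal]
    have h1 : Real.exp (-t ^ 2 - 1) ≤ Real.exp (-(x - 0) ^ 2 / (2 * ((1 : NNReal) : ℝ))) := by
      rw [Real.exp_le_exp]
      simp only [NNReal.coe_one]
      nlinarith [hx.1, hx.2, sq_nonneg (2 * t - x)]
    have h2 : 1 / 3 ≤ (√(2 * Real.pi * ((1 : NNReal) : ℝ)))⁻¹ := by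
      rw [one_div]
      refine inv_anti₀ (by positivity) (Real.sqrt_le_iff.2 ⟨by norm_num, ?_⟩)
      have := Real.pi_lt_d2
      simp only [NNReal.coe_one]; linarith
    have := mul_le_mul h2 h1 (Real.exp_pos _).le (by positivity)
    linarith
  have := setIntegral_mono_on (μ := volume) (s := Set.Ioo t (t + 1))
    (integrableOn_const (C := Real.exp (-t ^ 2 - 1) / 3) (by simp))
    (integrable_gaussianPDFReal 0 1).integrableOn measurableSet_Ioo hpdf
  refine le_trans (le_of_eq ?_) this
  simp

lemma exists_of_isMedian {n : ℕ} {r p M a : ℝ}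
    (hM : IsMedian (_root_.stdGaussian n) (lorNorm r p) M)
    (ha : _root_.stdGaussian n {y | lorSum r p y < a} < 1 / 2) :
    ∃ y : Fin n → ℝ, lorNorm r p y ≤ M ∧ a ≤ lorSum r p y := by
  by_contra! h
  exact (hM.2.trans (measure_mono fun y hy => h y hy)).not_gt ha

lemma le_rpow_of_isMedian {n : ℕ} {r p M a : ℝ} (hp : 1 ≤ p)
    (hM : IsMedian (_root_.stdGaussian n) (lorNorm r p) M)
    (ha : _root_.stdGaussian n {y | lorSum r p y < a} < 1 / 2) : a ≤ M ^ p := by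
  obtain ⟨y, h1, h2⟩ := exists_of_isMedian hM ha
  rw [← lorNorm_rpow hp] at h2
  exact h2.trans (Real.rpow_le_rpow (lorNorm_nonneg _ _ _) h1 (by linarith))

lemma ofReal_exp_lt_half {t : ℝ} (ht : t ≤ -(39 / 50)) :
    ENNReal.ofReal (Real.exp t) < 1 / 2 := by
  have h : Real.exp t < 1 / 2 := by
    have h1 : Real.exp t < Real.exp (-Real.log 2) := by
      rw [Real.exp_lt_exp]
      linarith [Real.log_two_lt_d9]
    rwa [Real.exp_neg, Real.exp_log (by norm_num), ← one_div] at h1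
  rw [ENNReal.ofReal_lt_iff_lt_toReal (Real.exp_pos _).le (by simp)]
  simpa using h

lemma median_nonneg {n : ℕ} {r p M : ℝ}
    (hM : IsMedian (_root_.stdGaussian n) (lorNorm r p) M) : 0 ≤ M := by
  obtain ⟨y, h1, -⟩ := exists_of_isMedian (a := 0) hM (by
    have : {y : Fin n → ℝ | lorSum r p y < 0} = ∅ := by
      ext y
      simpa using lorSum_nonneg r p y
    rw [this]; simp)
  exact (lorNorm_nonneg _ _ _).trans h1

lemma median_rpow_ge {n : ℕ} {r p M : ℝ} (hn : 2 ≤ n) (hr : 0 ≤ r) (hp : 1 ≤ p)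
    (hM : IsMedian (_root_.stdGaussian n) (lorNorm r p) M) :
    (1 / 5) ^ p / 100 * (n : ℝ) ^ (1 - r) ≤ M ^ p := by
  have hn0 : (0 : ℝ) < n := by exact_mod_cast (by omega : 0 < n)
  have hn2 : (2 : ℝ) ≤ n := by exact_mod_cast hn
  refine le_rpow_of_isMedian hp hM ?_
  refine lt_of_le_of_lt (measure_mono ?_) (lt_of_le_of_lt
    (measure_largeCount_le n (1 / 5) (n / 100)) (ofReal_exp_lt_half ?_))
  · intro y hy
    simp only [Set.mem_ofPred_eq] at hy ⊢
    by_contra! hc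
    refine absurd hy (not_lt.2 (le_trans ?_
      (le_lorSum (by linarith) (by norm_num : (0 : ℝ) ≤ 1 / 5) y)))
    have hs : (largeCount (1 / 5) y : ℝ) * (n : ℝ) ^ (-r) ≤
        ∑ i ∈ Finset.range (largeCount (1 / 5) y), ((i : ℝ) + 1) ^ (-r) := by
      have := Finset.card_nsmul_le_sum (Finset.range (largeCount (1 / 5) y))
        (fun i => ((i : ℝ) + 1) ^ (-r)) ((n : ℝ) ^ (-r)) fun i hi => by
          refine Real.rpow_le_rpow_of_nonpos (by positivity) ?_ (by linarith)
          exact_mod_cast (Finset.mem_range.1 hi).trans_le (largeCount_le _ y)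
      simpa using this
    have e : (n : ℝ) ^ (1 - r) = n * (n : ℝ) ^ (-r) := by
      rw [sub_eq_add_neg, Real.rpow_add hn0, Real.rpow_one]
    have hq : 0 < (n : ℝ) ^ (-r) := by positivity
    calc (1 / 5) ^ p / 100 * (n : ℝ) ^ (1 - r) = (1 / 5) ^ p * (n / 100 * (n : ℝ) ^ (-r)) := by
          rw [e]; ring
      _ ≤ (1 / 5) ^ p * (largeCount (1 / 5) y * (n : ℝ) ^ (-r)) := by gcongr
      _ ≤ _ := mul_le_mul_of_nonneg_left hs (by positivity)
  · have := measureReal_gaussian_tail_ge_small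
    nlinarith

lemma median_rpow_ge_one {n : ℕ} {p M : ℝ} (hn : 19 ^ 4 ≤ n) (hp : 1 ≤ p)
    (hM : IsMedian (_root_.stdGaussian n) (lorNorm 1 p) M) :
    (√(Real.log n) / 2) ^ p * (Real.log n / 2) ≤ M ^ p := by
  have hn0 : (0 : ℝ) < n := by exact_mod_cast (by omega : 0 < n)
  have hl0 : 0 < Real.log n := log_pos_of_two_le (by omega)
  refine le_rpow_of_isMedian hp hM ?_
  refine lt_of_le_of_lt (measure_mono ?_) (lt_of_le_of_lt
    (measure_largeCount_le n (√(Real.log n) / 2) (√n)) (ofReal_exp_lt_half ?_))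
  · intro y hy
    simp only [Set.mem_ofPred_eq] at hy ⊢
    by_contra! hc
    have hδ : 0 ≤ √(Real.log n) / 2 := by positivity
    refine absurd hy (not_lt.2 (le_trans ?_ (le_lorSum (by linarith) hδ y)))
    refine mul_le_mul_of_nonneg_left ?_ (by positivity)
    have h1 : Real.log (largeCount (√(Real.log n) / 2) y + 1) ≤
        (harmonic (largeCount (√(Real.log n) / 2) y) : ℝ) := by
      exact_mod_cast log_add_one_le_harmonic (largeCount (√(Real.log n) / 2) y)
    have h2 : Real.log n / 2 ≤ Real.log (largeCount (√(Real.log n) / 2) y + 1) := by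
      rw [← Real.log_sqrt hn0.le]
      exact Real.log_le_log (by positivity) (by linarith)
    refine h2.trans (h1.trans (le_of_eq ?_))
    rw [harmonic]
    push_cast
    exact Finset.sum_congr rfl fun i _ => (Real.rpow_neg_one _).symm
  · have ht := measureReal_gaussian_tail_ge (√(Real.log n) / 2)
    have e : -(√(Real.log n) / 2) ^ 2 - 1 = -(Real.log n / 4) - 1 := by
      rw [div_pow, Real.sq_sqrt hl0.le]; norm_num
    rw [e] at ht
    set x := Real.exp (Real.log n / 4) with hx
    have hx0 : 0 < x := Real.exp_pos _
    have hx4 : x ^ 4 = n := by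
      rw [hx, ← Real.exp_nat_mul]
      push_cast
      rw [mul_div_cancel₀ _ (by norm_num : (4 : ℝ) ≠ 0), Real.exp_log hn0]
    have hx19 : 19 ≤ x := by
      refine le_of_pow_le_pow_left₀ (n := 4) (by norm_num) hx0.le ?_
      rw [hx4]; exact_mod_cast hn
    have hs : √(n : ℝ) = x ^ 2 := by
      rw [← hx4, show x ^ 4 = (x ^ 2) ^ 2 by ring, Real.sqrt_sq (by positivity)]
    have he : 1 / (9 * x) ≤ Real.exp (-(Real.log n / 4) - 1) / 3 := by
      rw [sub_eq_add_neg, Real.exp_add, Real.exp_neg, ← hx, Real.exp_neg]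
      have h3 : Real.exp 1 ≤ 3 := by linarith [Real.exp_one_lt_d9]
      have h4 : 1 / 3 ≤ (Real.exp 1)⁻¹ := by
        rw [one_div]; exact inv_anti₀ (Real.exp_pos _) h3
      have h5 : 0 < x⁻¹ := by positivity
      calc 1 / (9 * x) = x⁻¹ * (1 / 3) / 3 := by field_simp; norm_num
        _ ≤ _ := by gcongr
    have h6 := he.trans ht
    rw [hs]
    have h7 : (n : ℝ) * (1 / (9 * x)) = x ^ 3 / 9 := by
      rw [← hx4]; field_simp
    have h8 := mul_le_mul_of_nonneg_left h6 hn0.le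
    rw [h7] at h8
    nlinarith [mul_nonneg (sq_nonneg x) (sub_nonneg.2 hx19),
      mul_le_mul hx19 hx19 (by norm_num) hx0.le]

lemma exists_medianSq_le {r p : ℝ} (hr : 0 ≤ r) (hr1 : r ≤ 1) (hp : 1 ≤ p) :
    ∃ K > 0, ∀ (n : ℕ) (M : ℝ), 2 ≤ n → IsMedian (_root_.stdGaussian n) (lorNorm r p) M →
      K * medianSq n r p ≤ (M ^ p) ^ 2 := by
  rcases hr1.lt_or_eq with h | h
  · refine ⟨((1 / 5) ^ p / 100) ^ 2, by positivity, fun n M hn hM => ?_⟩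
    have hn0 : (0 : ℝ) < n := by exact_mod_cast (by omega : 0 < n)
    rw [medianSq, if_pos h]
    have := pow_le_pow_left₀ (by positivity) (median_rpow_ge hn hr hp hM) 2
    refine le_trans (le_of_eq ?_) this
    rw [mul_pow, ← Real.rpow_natCast ((n : ℝ) ^ (1 - r)), ← Real.rpow_mul hn0.le]
    congr 2; push_cast; ring
  · subst h
    set K₁ : ℝ := ((1 / 5) ^ p / 100) ^ 2 / Real.log (19 ^ 4) ^ (p + 2) with hK₁
    set K₂ : ℝ := ((1 / 2) ^ p / 2) ^ 2 with hK₂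
    have hl19 : 0 < Real.log (19 ^ 4) := Real.log_pos (by norm_num)
    have hK₁0 : 0 < K₁ := by positivity
    have hK₂0 : 0 < K₂ := by positivity
    refine ⟨min K₁ K₂, lt_min hK₁0 hK₂0, fun n M hn hM => ?_⟩
    have hn0 : (0 : ℝ) < n := by exact_mod_cast (by omega : 0 < n)
    have hl0 := log_pos_of_two_le hn
    rw [medianSq, if_neg (lt_irrefl _)]
    rcases le_or_gt (19 ^ 4) n with h4 | h4
    · have := pow_le_pow_left₀ (by positivity) (median_rpow_ge_one h4 hp hM) 2
      refine le_trans ?_ this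
      refine (mul_le_mul_of_nonneg_right (min_le_right _ _) (by positivity)).trans (le_of_eq ?_)
      rw [hK₂, Real.rpow_add hl0, div_eq_mul_one_div (√(Real.log n)),
        Real.mul_rpow (by positivity) (by positivity), Real.sqrt_eq_rpow, ← Real.rpow_mul hl0.le]
      have e : (Real.log n ^ (1 / 2 * p)) ^ 2 = Real.log n ^ p := by
        rw [← Real.rpow_natCast, ← Real.rpow_mul hl0.le]
        congr 1; push_cast; ring
      rw [mul_pow, mul_pow, e]
      norm_num
      ring
    · have := pow_le_pow_left₀ (by positivity) (median_rpow_ge hn hr hp hM) 2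
      refine le_trans ?_ this
      refine (mul_le_mul_of_nonneg_right (min_le_left _ _) (by positivity)).trans ?_
      rw [sub_self, Real.rpow_zero, mul_one, hK₁, div_mul_eq_mul_div]
      refine div_le_of_le_mul₀ (by positivity) (by positivity) ?_
      refine mul_le_mul_of_nonneg_left (Real.rpow_le_rpow hl0.le ?_ (by linarith)) (by positivity)
      exact Real.log_le_log hn0 (by exact_mod_cast h4.le)

lemma SqBounded.mono {n : ℕ} {C C' q : ℝ} {y : Fin n → ℝ} (hC : 0 < C) (hCC : C ≤ C')
    (h : SqBounded C q y) : SqBounded C' q y := by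
  intro I hI
  have h1 := h I hI
  have h2 : 0 ≤ ∑ i ∈ I, y i ^ 2 := Finset.sum_nonneg fun i _ => sq_nonneg _
  have h3 : 0 ≤ topEntropy n I.card + q := by
    by_contra! hlt
    nlinarith
  exact h1.trans (mul_le_mul_of_nonneg_right hCC h3)

lemma logPart_pos {n : ℕ} (hn : 2 ≤ n) (r p : ℝ) : 0 < logPart n r p :=
  Finset.sum_pos (fun i _ => mul_pos (by positivity)
    (Real.rpow_pos_of_pos (by linarith [one_add_log_ge_one i]) _))
    ⟨⟨0, by omega⟩, Finset.mem_univ _⟩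

lemma quarter_le_of_half_le {n : ℕ} {q : ℝ} (hq : 1 ≤ q) {A B : Set (Fin n → ℝ)}
    (hA : (1 : ENNReal) / 2 ≤ _root_.stdGaussian n A)
    (hAB : ∀ y ∈ A, SqBounded 12 q y → y ∈ B) : 1 / 4 ≤ _root_.stdGaussian n B := by
  have h1 : _root_.stdGaussian n {y | ¬ SqBounded 12 q y} ≤ 1 / 4 := by
    refine (measure_not_sqBounded q).trans ?_
    have h2 : Real.exp (-3 * q - 1) ≤ 1 / 4 := by
      have h3 : Real.exp (-3 * q - 1) ≤ Real.exp (-Real.log 4) := by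
        rw [Real.exp_le_exp, show (4 : ℝ) = 2 ^ 2 by norm_num, Real.log_pow]
        push_cast
        linarith [Real.log_two_lt_d9]
      rwa [Real.exp_neg, Real.exp_log (by norm_num), ← one_div] at h3
    refine (ENNReal.ofReal_le_ofReal h2).trans (le_of_eq ?_)
    rw [ENNReal.ofReal_div_of_pos (by norm_num)]
    simp
  have h2 : _root_.stdGaussian n A ≤
      _root_.stdGaussian n B + _root_.stdGaussian n {y | ¬ SqBounded 12 q y} := by
    refine (measure_mono fun y hy => ?_).trans (measure_union_le _ _)
    by_cases h : SqBounded 12 q y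
    · exact Or.inl (hAB y hy h)
    · exact Or.inr h
  have h3 : (1 : ENNReal) / 4 + 1 / 4 = 1 / 2 := by
    rw [ENNReal.div_add_div_same, ← ENNReal.toReal_eq_toReal_iff' (by finiteness) (by finiteness)]
    norm_num
  have h4 := hA.trans (h2.trans (add_le_add_right h1 _))
  rw [← h3] at h4
  exact ENNReal.le_of_add_le_add_right (by finiteness) h4

lemma measure_exists_lorSum_sub_gt {n k : ℕ} {r p ε M q : ℝ} (hn : 2 ≤ n) (hr : 0 ≤ r)
    (hp : 1 ≤ p) (hε : 0 ≤ ε) (hM : IsMedian (_root_.stdGaussian n) (lorNorm r p) M)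
    (hq : 1 ≤ q) (hk : (k : ℝ) ≤ q)
    (hs : 1600 * (p ^ 2 * 96 ^ (p - 1)) * (q * (logPart n r p + q ^ (p - 1) * dimPart n r p)) ≤
      (ε * M ^ p) ^ 2) :
    gaussMatrix n k {g | ∃ x : EuclideanSpace ℝ (Fin k), ‖x‖ = 1 ∧
      ε * M ^ p < |lorSum r p (mulVec g x.ofLp) - M ^ p|} ≤
        ENNReal.ofReal (11 * Real.exp (-q)) := by
  have hM0 := median_nonneg hM
  have hq0 : 0 < q := by linarith
  set T := logPart n r p + q ^ (p - 1) * dimPart n r p with hT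
  have hT0 : 0 < T := add_pos_of_pos_of_nonneg (logPart_pos hn r p)
    (mul_nonneg (by positivity) (dimPart_nonneg _ _ _))
  set L : NNReal := (√(p ^ 2 * 96 ^ (p - 1) * T)).toNNReal with hL
  have hLr : (L : ℝ) = √(p ^ 2 * 96 ^ (p - 1) * T) := Real.coe_toNNReal _ (Real.sqrt_nonneg _)
  have hL0 : 0 < L := by
    rw [← NNReal.coe_pos, hLr]; positivity
  obtain ⟨F, hF, hFeq⟩ := (lipschitzOnWith_lorSum (n := n) hr hp L).extend_real
  have hFy : ∀ y : Fin n → ℝ, SqBounded 48 q y → F (WithLp.toLp 2 y) = lorSum r p y := by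
    intro y hy
    refine (hFeq ?_).symm
    simp only [Set.mem_ofPred_eq]
    rw [hLr, ← Real.sqrt_sq (by linarith : 0 ≤ p), ← Real.sqrt_mul (by positivity),
      Real.sqrt_sq (by linarith : 0 ≤ p)]
    refine Real.sqrt_le_sqrt ?_
    rw [mul_assoc]
    refine mul_le_mul_of_nonneg_left ?_ (by positivity)
    have := gradSq_le hr hp (by norm_num) hq0 hy
    norm_num at this
    exact this
  have hthr : 40 * L * √q ≤ ε * M ^ p := by
    refine le_of_pow_le_pow_left₀ two_ne_zero (by positivity) (le_trans (le_of_eq ?_) hs)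
    rw [hLr, mul_pow, mul_pow, Real.sq_sqrt (by positivity), Real.sq_sqrt hq0.le]
    ring
  have h1 : 1 / 4 ≤ _root_.stdGaussian n {y | F (WithLp.toLp 2 y) ≤ M ^ p} :=
    quarter_le_of_half_le hq hM.2 fun y hy hb => by
      simp only [Set.mem_ofPred_eq] at hy ⊢
      rw [hFy y (hb.mono (by norm_num) (by norm_num)), ← lorNorm_rpow hp]
      exact Real.rpow_le_rpow (lorNorm_nonneg _ _ _) hy (by linarith)
  have h2 : 1 / 4 ≤ _root_.stdGaussian n {y | M ^ p ≤ F (WithLp.toLp 2 y)} :=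
    quarter_le_of_half_le hq hM.1 fun y hy hb => by
      simp only [Set.mem_ofPred_eq] at hy ⊢
      rw [hFy y (hb.mono (by norm_num) (by norm_num)), ← lorNorm_rpow hp]
      exact Real.rpow_le_rpow hM0 hy (by linarith)
  have hA := measure_exists_abs_sub_gt hF hL0 hq hk h1 h2
  have hB := measure_exists_not_sqBounded (n := n) hq hk
  refine (measure_mono ?_).trans ((measure_union_le _ _).trans ((add_le_add hA hB).trans
    (le_of_eq ?_)))
  · rintro g ⟨x, hx, hg⟩
    by_cases hb : SqBounded 48 q (mulVec g x.ofLp)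
    · refine Or.inl ⟨x, hx, hthr.trans_lt ?_⟩
      rw [eucMulVec, hFy _ hb]
      exact hg
    · exact Or.inr ⟨x, hx, hb⟩
  · rw [show (10 : ENNReal) = ENNReal.ofReal 10 by simp, ← ENNReal.ofReal_mul (by norm_num),
      ← ENNReal.ofReal_add (by positivity) (by positivity)]
    congr 1; ring

lemma lorNorm_bounds_of_lorSum {n : ℕ} {r p ε M : ℝ} {y : Fin n → ℝ} (hp : 1 ≤ p) (hε : 0 < ε)
    (hε1 : ε < 1) (hM : 0 ≤ M) (h : |lorSum r p y - M ^ p| ≤ ε * M ^ p) :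
    (1 - ε) * M ≤ lorNorm r p y ∧ lorNorm r p y ≤ (1 + ε) * M := by
  rw [← lorNorm_rpow hp] at h
  obtain ⟨h1, h2⟩ := abs_le.1 h
  have hMp : 0 ≤ M ^ p := by positivity
  have hp0 : 0 < p := by linarith
  constructor
  · rw [← Real.rpow_le_rpow_iff (mul_nonneg (by linarith) hM) (lorNorm_nonneg _ _ _) hp0,
      Real.mul_rpow (by linarith) hM]
    have := Real.rpow_le_rpow_of_exponent_ge (x := 1 - ε) (by linarith) (by linarith) hp
    rw [Real.rpow_one] at this
    nlinarith
  · rw [← Real.rpow_le_rpow_iff (lorNorm_nonneg _ _ _) (by positivity) hp0,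
      Real.mul_rpow (by linarith) hM]
    have := Real.rpow_le_rpow_of_exponent_le (x := 1 + ε) (by linarith) hp
    rw [Real.rpow_one] at this
    nlinarith

lemma mulVec_smul {n k : ℕ} (g : Fin n → Fin k → ℝ) (c : ℝ) (x : Fin k → ℝ) :
    mulVec g (c • x) = c • mulVec g x := by
  funext i
  simp only [mulVec, Pi.smul_apply, smul_eq_mul, Finset.mul_sum]
  exact Finset.sum_congr rfl fun j _ => by ring

lemma eucNorm_eq_norm {k : ℕ} (x : Fin k → ℝ) : eucNorm x = ‖WithLp.toLp 2 x‖ := by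
  simp [eucNorm, EuclideanSpace.norm_eq]

lemma lorNorm_zero {n : ℕ} {r p : ℝ} (hr : 0 ≤ r) (hp : 1 ≤ p) :
    lorNorm r p (0 : Fin n → ℝ) = 0 := by
  simpa using lorNorm_smul hr hp le_rfl (0 : Fin n → ℝ)

lemma lorNorm_mulVec_bounds_of_unit {n k : ℕ} {r p a b : ℝ} (hr : 0 ≤ r) (hp : 1 ≤ p)
    {g : Fin n → Fin k → ℝ}
    (h : ∀ x : EuclideanSpace ℝ (Fin k), ‖x‖ = 1 →
      a ≤ lorNorm r p (mulVec g x.ofLp) ∧ lorNorm r p (mulVec g x.ofLp) ≤ b) (x : Fin k → ℝ) :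
    a * eucNorm x ≤ lorNorm r p (mulVec g x) ∧ lorNorm r p (mulVec g x) ≤ b * eucNorm x := by
  rw [eucNorm_eq_norm]
  set z : EuclideanSpace ℝ (Fin k) := WithLp.toLp 2 x with hz
  have hxz : x = z.ofLp := rfl
  rcases eq_or_ne z 0 with h0 | h0
  · have hx0 : x = 0 := by rw [hxz, h0]; rfl
    have : mulVec g x = 0 := by
      rw [hx0]; funext i; simp [mulVec]
    rw [this, h0, lorNorm_zero hr hp]
    simp
  · have hn : 0 < ‖z‖ := norm_pos_iff.2 h0
    obtain ⟨h1, h2⟩ := h (‖z‖⁻¹ • z) (norm_smul_inv_norm h0)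
    have e : lorNorm r p (mulVec g x) = ‖z‖ * lorNorm r p (mulVec g (‖z‖⁻¹ • z).ofLp) := by
      rw [← lorNorm_smul hr hp hn.le, ← mulVec_smul, WithLp.ofLp_smul, smul_smul,
        mul_inv_cancel₀ hn.ne', one_smul]
    rw [e]
    constructor <;> nlinarith

lemma one_sub_le_measure_bounds {n k : ℕ} {r p ε M q : ℝ} (hn : 2 ≤ n) (hr : 0 ≤ r)
    (hp : 1 ≤ p) (hε : 0 < ε) (hε1 : ε < 1)
    (hM : IsMedian (_root_.stdGaussian n) (lorNorm r p) M) (hq : 1 ≤ q) (hk : (k : ℝ) ≤ q)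
    (hs : 1600 * (p ^ 2 * 96 ^ (p - 1)) * (q * (logPart n r p + q ^ (p - 1) * dimPart n r p)) ≤
      (ε * M ^ p) ^ 2) :
    1 - 11 * Real.exp (-q) ≤ ((gaussMatrix n k) {g | ∀ x : Fin k → ℝ,
      (1 - ε) * M * eucNorm x ≤ lorNorm r p (mulVec g x) ∧
      lorNorm r p (mulVec g x) ≤ (1 + ε) * M * eucNorm x}).toReal := by
  have hbad := measure_exists_lorSum_sub_gt hn hr hp hε.le hM hq hk hs
  have huniv : (Set.univ : Set (Fin n → Fin k → ℝ)) ⊆ {g | ∀ x : Fin k → ℝ,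
      (1 - ε) * M * eucNorm x ≤ lorNorm r p (mulVec g x) ∧
      lorNorm r p (mulVec g x) ≤ (1 + ε) * M * eucNorm x} ∪
      {g | ∃ x : EuclideanSpace ℝ (Fin k), ‖x‖ = 1 ∧
        ε * M ^ p < |lorSum r p (mulVec g x.ofLp) - M ^ p|} := by
    intro g _
    by_cases hg : ∃ x : EuclideanSpace ℝ (Fin k), ‖x‖ = 1 ∧
        ε * M ^ p < |lorSum r p (mulVec g x.ofLp) - M ^ p|
    · exact Or.inr hg
    · push Not at hg
      exact Or.inl (lorNorm_mulVec_bounds_of_unit hr hp fun x hx =>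
        lorNorm_bounds_of_lorSum hp hε hε1 (median_nonneg hM) (hg x hx))
  have h1 := measureReal_mono (μ := gaussMatrix n k) huniv
  have h2 := h1.trans (measureReal_union_le _ _)
  rw [probReal_univ] at h2
  have h3 := ENNReal.toReal_mono ENNReal.ofReal_ne_top hbad
  rw [ENNReal.toReal_ofReal (by positivity)] at h3
  simp only [measureReal_def] at h2
  linarith

lemma exists_dim_coefficient {r p : ℝ} (hr : 0 ≤ r) (hr1 : r ≤ 1) (hp : 1 ≤ p) :
    ∃ c > 0, ∀ (n k : ℕ) (ε : ℝ), 2 ≤ n → 0 < ε → ε < 1 → (k : ℝ) ≤ c * dimAsy n r p ε →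
      ∀ M : ℝ, IsMedian (_root_.stdGaussian n) (lorNorm r p) M →
        1 - 11 * Real.exp (-1 * (c * dimAsy n r p ε)) ≤
          ((gaussMatrix n k) {g | ∀ x : Fin k → ℝ,
            (1 - ε) * M * eucNorm x ≤ lorNorm r p (mulVec g x) ∧
            lorNorm r p (mulVec g x) ≤ (1 + ε) * M * eucNorm x}).toReal := by
  obtain ⟨K₁, hK₁, h₁⟩ := exists_dimAsy_mul_logPart_le hr hr1 hp
  obtain ⟨K₂, hK₂, h₂⟩ := exists_dimAsy_rpow_mul_dimPart_le hr hr1 hp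
  obtain ⟨K₃, hK₃, h₃⟩ := exists_medianSq_le hr hr1 hp
  set A : ℝ := 1600 * (p ^ 2 * 96 ^ (p - 1)) with hA
  have hA0 : 0 < A := by positivity
  set c : ℝ := min 1 (K₃ / (A * (K₁ + K₂))) with hc
  have hc0 : 0 < c := lt_min one_pos (by positivity)
  have hc1 : c ≤ 1 := min_le_left _ _
  have hcK : A * (c * (K₁ + K₂)) ≤ K₃ := by
    have : c ≤ K₃ / (A * (K₁ + K₂)) := min_le_right _ _
    rw [le_div_iff₀ (by positivity)] at this
    linarith
  refine ⟨c, hc0, fun n k ε hn hε hε1 hk M hM => ?_⟩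
  rcases Nat.eq_zero_or_pos k with rfl | hk0
  · have huniv : {g : Fin n → Fin 0 → ℝ | ∀ x : Fin 0 → ℝ,
        (1 - ε) * M * eucNorm x ≤ lorNorm r p (mulVec g x) ∧
        lorNorm r p (mulVec g x) ≤ (1 + ε) * M * eucNorm x} = Set.univ := by
      refine Set.eq_univ_of_forall fun g x => ?_
      have h0 : mulVec g x = 0 := by funext i; simp [mulVec]
      have h1 : eucNorm x = 0 := by simp [eucNorm]
      rw [h0, h1, lorNorm_zero hr hp]
      simp
    rw [huniv, measure_univ, ENNReal.toReal_one]
    have := Real.exp_pos (-1 * (c * dimAsy n r p ε))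
    linarith
  · have hk1 : (1 : ℝ) ≤ k := by exact_mod_cast hk0
    set D := dimAsy n r p ε with hD
    have hD0 : 0 < D := dimAsy_pos hn hε
    have e : -1 * (c * D) = -(c * D) := by ring
    rw [e]
    refine one_sub_le_measure_bounds hn hr hp hε hε1 hM (hk1.trans hk) hk ?_
    have g₁ := h₁ n ε hn hε hε1
    have g₂ := h₂ n ε hn hε hε1
    have g₃ := h₃ n M hn hM
    rw [← hD] at g₁ g₂
    have hm0 : 0 ≤ medianSq n r p := by
      have := log_pos_of_two_le hn
      unfold medianSq
      split_ifs <;> positivity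
    have e1 : (c * D) * (c * D) ^ (p - 1) ≤ c * D ^ p := by
      have e2 : (c * D) * (c * D) ^ (p - 1) = (c * D) ^ p := by
        rw [mul_comm, ← Real.rpow_add_one (by positivity)]; congr 1; ring
      rw [e2, Real.mul_rpow hc0.le hD0.le]
      refine mul_le_mul_of_nonneg_right ?_ (by positivity)
      have := Real.rpow_le_rpow_of_exponent_ge hc0 hc1 hp
      rwa [Real.rpow_one] at this
    have e3 : (c * D) * (logPart n r p + (c * D) ^ (p - 1) * dimPart n r p) ≤
        c * (K₁ + K₂) * (medianSq n r p * ε ^ 2) := by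
      have := mul_le_mul_of_nonneg_right e1 (dimPart_nonneg n r p)
      nlinarith [mul_le_mul_of_nonneg_left g₁ hc0.le, mul_le_mul_of_nonneg_left g₂ hc0.le]
    calc A * ((c * D) * (logPart n r p + (c * D) ^ (p - 1) * dimPart n r p))
        ≤ A * (c * (K₁ + K₂) * (medianSq n r p * ε ^ 2)) := mul_le_mul_of_nonneg_left e3 hA0.le
      _ = A * (c * (K₁ + K₂)) * (medianSq n r p * ε ^ 2) := by ring
      _ ≤ K₃ * (medianSq n r p * ε ^ 2) := mul_le_mul_of_nonneg_right hcK (by positivity)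
      _ = K₃ * medianSq n r p * ε ^ 2 := by ring
      _ ≤ (M ^ p) ^ 2 * ε ^ 2 := mul_le_mul_of_nonneg_right g₃ (by positivity)
      _ = (ε * M ^ p) ^ 2 := by ring

/-- Randomized Dvoretzky for the Lorentz spaces `|·|_{r,p}` with improved dependence on `ε`
(Corollary `Corrasy`): there are universal constants `C, c > 0` and coefficients
`c_{r,p} > 0` such that for `n ≥ 2`, `ε ∈ (0,1)` and `k ≤ d' = c_{r,p} · dimAsy n r p ε`,
with probability at least `1 - C exp(-c d')`, for all `x ∈ ℝ^k`,
`(1-ε) M_{r,p} |x| ≤ |Gx|_{r,p} ≤ (1+ε) M_{r,p} |x|`, where `M_{r,p}` is a median of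
`|·|_{r,p}` under the standard Gaussian on `ℝ^n` (the law of `Ge₁`). -/
theorem dvoretzky_lorentz_improved_epsilon :
    ∃ C c : ℝ, 0 < C ∧ 0 < c ∧
      ∃ c' : ℝ → ℝ → ℝ,
        (∀ r p : ℝ, 0 ≤ r → r ≤ 1 → 1 ≤ p → 0 < c' r p) ∧
        ∀ (n k : ℕ) (r p ε : ℝ), 2 ≤ n → 0 ≤ r → r ≤ 1 → 1 ≤ p →
          0 < ε → ε < 1 →
          (k : ℝ) ≤ c' r p * dimAsy n r p ε →
          ∀ M : ℝ, IsMedian (stdGaussian n) (lorNorm r p) M →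
            1 - C * Real.exp (-c * (c' r p * dimAsy n r p ε)) ≤
              ((gaussMatrix n k) {g | ∀ x : Fin k → ℝ,
                (1 - ε) * M * eucNorm x ≤ lorNorm r p (mulVec g x) ∧
                lorNorm r p (mulVec g x) ≤ (1 + ε) * M * eucNorm x}).toReal := by
  choose c hc h using fun (r p : ℝ) (hr : 0 ≤ r) (hr1 : r ≤ 1) (hp : 1 ≤ p) =>
    exists_dim_coefficient hr hr1 hp
  classical
  refine ⟨11, 1, by norm_num, one_pos,
    fun r p => if hrp : 0 ≤ r ∧ r ≤ 1 ∧ 1 ≤ p then c r p hrp.1 hrp.2.1 hrp.2.2 else 1, ?_, ?_⟩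
  · intro r p hr hr1 hp
    simp only [dif_pos (show 0 ≤ r ∧ r ≤ 1 ∧ 1 ≤ p from ⟨hr, hr1, hp⟩)]
    exact hc r p hr hr1 hp
  · intro n k r p ε hn hr hr1 hp hε hε1
    simp only [dif_pos (show 0 ≤ r ∧ r ≤ 1 ∧ 1 ≤ p from ⟨hr, hr1, hp⟩)]
    exact h r p hr hr1 hp n k ε hn hε hε1
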